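/- Let C be a bounded open convex subset of ℝ². Then the Cheeger constant I_∞(C) is nonzero if and only if the Hilbert metric space (C, d_C) is Gromov hyperbolic (i.e. δ-hyperbolic for some δ ≥ 0). -/

import Mathlib

open MeasureTheory Set Filter
open scoped ENNReal NNReal

noncomputable section

/-- Euclidean `n`-space. -/
abbrev Euc (n : ℕ) : Type := EuclideanSpace ℝ (Fin n)

/-- The set of parameters `t` such that `p + t • v` lies in `C`. For `C` open bounded
convex, `p ∈ C` and `v ≠ 0` this is an open interval `(t⁻, t⁺)` with `t⁻ < 0 < t⁺`;
the points `p + t⁻ • v` and `p + t⁺ • v` are the two intersections of the boundary `∂C`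
with the line through `p` directed by `v`. -/
def lineParams {n : ℕ} (C : Set (Euc n)) (p v : Euc n) : Set ℝ := {t : ℝ | p + t • v ∈ C}

open Classical in
/-- The Hilbert distance of the convex set `C`: with `a = p + t⁻ • (q - p)` and
`b = p + t⁺ • (q - p)` the two boundary points (so that `a, p, q, b` are in this order),
the cross-ratio `(‖q-a‖ ‖p-b‖)/(‖p-a‖ ‖q-b‖)` equals `((1 - t⁻) t⁺)/((-t⁻)(t⁺ - 1))`. -/
def hDist {n : ℕ} (C : Set (Euc n)) (p q : Euc n) : ℝ :=
  if p = q then 0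
  else
    (1 / 2) * Real.log
      (((1 - sInf (lineParams C p (q - p))) * sSup (lineParams C p (q - p))) /
        ((-sInf (lineParams C p (q - p))) * (sSup (lineParams C p (q - p)) - 1)))

open Classical in
/-- The Hilbert Finsler norm of `u` at `p`: with `p⁺ = p + t⁺ • u`, `p⁻ = p + t⁻ • u`
the two boundary points on the line through `p` directed by `u`, one has
`(1/2)‖u‖(1/‖p-p⁺‖ + 1/‖p-p⁻‖) = (1/2)(1/t⁺ - 1/t⁻)`. -/
def fNorm {n : ℕ} (C : Set (Euc n)) (p u : Euc n) : ℝ :=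
  if u = 0 then 0
  else (1 / 2) * (1 / sSup (lineParams C p u) - 1 / sInf (lineParams C p u))

/-- The dual norm of a linear form `l` at `p`: `sup {l u : ‖u‖_{C,p} = 1}`. -/
def dualNorm {n : ℕ} (C : Set (Euc n)) (p : Euc n) (l : Euc n →L[ℝ] ℝ) : ℝ :=
  sSup ((fun u => l u) '' {u : Euc n | fNorm C p u = 1})

/-- The tangent ball `TB_R(p) = {u : ‖u‖_{C,p} < R}`. -/
def tangentBall {n : ℕ} (C : Set (Euc n)) (p : Euc n) (R : ℝ) : Set (Euc n) :=
  {u : Euc n | fNorm C p u < R}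

/-- `ωₙ`, the Lebesgue volume of the Euclidean unit ball of `ℝⁿ`. -/
def omegaVol (n : ℕ) : ℝ := (volume (Metric.ball (0 : Euc n) 1)).toReal

/-- The Hilbert (Busemann) measure of `C`: density `ωₙ / vol_e(TB_C(p))` against
Lebesgue measure, supported on `C`. -/
def hMeasure {n : ℕ} (C : Set (Euc n)) : Measure (Euc n) :=
  (volume.restrict C).withDensity fun p =>
    ENNReal.ofReal (omegaVol n / (volume (tangentBall C p 1)).toReal)

/-- Admissible test functions: nonzero Lipschitz functions with compact support
contained in `Ω`. -/
def testFuns {n : ℕ} (Ω : Set (Euc n)) : Set (Euc n → ℝ) :=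
  {f : Euc n → ℝ |
    (∃ K : ℝ≥0, LipschitzWith K f) ∧ f ≠ 0 ∧ HasCompactSupport f ∧ tsupport f ⊆ Ω}

/-- The Rayleigh quotient of `f` on `Ω`, with respect to the Hilbert geometry of `C`
(`df` is the a.e.-defined differential of the Lipschitz function `f`). -/
def rayleigh {n : ℕ} (C Ω : Set (Euc n)) (f : Euc n → ℝ) : ℝ :=
  (∫ p in Ω, dualNorm C p (fderiv ℝ f p) ^ 2 ∂hMeasure C) /
    ∫ p in Ω, f p ^ 2 ∂hMeasure C

/-- The Dirichlet bottom of the spectrum `λ₁^C(Ω)`. -/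
def lambda1D {n : ℕ} (C Ω : Set (Euc n)) : ℝ := sInf (rayleigh C Ω '' testFuns Ω)

/-- The bottom of the spectrum `λ₁(C)` of the Hilbert geometry of `C`. -/
def lambda1 {n : ℕ} (C : Set (Euc n)) : ℝ := lambda1D C C

/-- The Gromov product `(x|y)_t = (d(x,t) + d(y,t) - d(x,y))/2`. -/
def gromovProd {n : ℕ} (d : Euc n → Euc n → ℝ) (x y t : Euc n) : ℝ :=
  (d x t + d y t - d x y) / 2

/-- `(C, d_C)` is `δ`-hyperbolic: for all `x y z t` in `C`,
`(x|y)_t ≥ min((x|z)_t, (y|z)_t) - δ`. -/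
def IsDeltaHyp {n : ℕ} (C : Set (Euc n)) (δ : ℝ) : Prop :=
  ∀ x ∈ C, ∀ y ∈ C, ∀ z ∈ C, ∀ t ∈ C,
    gromovProd (hDist C) x y t ≥
      min (gromovProd (hDist C) x z t) (gromovProd (hDist C) y z t) - δ

/-- The metric ball `B_R(x)` of the Hilbert metric of `C`. -/
def hBall {n : ℕ} (C : Set (Euc n)) (x : Euc n) (R : ℝ) : Set (Euc n) :=
  {y ∈ C | hDist C x y < R}

/-- The image of `C` under the homothety of center `P₀` and ratio `r`. -/
def homoth {n : ℕ} (P₀ : Euc n) (r : ℝ) (C : Set (Euc n)) : Set (Euc n) :=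
  (fun x => P₀ + r • (x - P₀)) '' C

/-- Diameter of a set with respect to a distance function `d`. -/
def ediamD {α : Type*} (d : α → α → ℝ) (S : Set α) : ℝ≥0∞ :=
  ⨆ x ∈ S, ⨆ y ∈ S, ENNReal.ofReal (d x y)

/-- The `k`-dimensional Hausdorff measure of `S` with respect to the distance
function `d`. -/
def hausD {α : Type*} (k : ℝ) (d : α → α → ℝ) (S : Set α) : ℝ≥0∞ :=
  ⨆ (ε : ℝ≥0∞) (_ : 0 < ε),
    ⨅ (U : ℕ → Set α) (_ : S ⊆ ⋃ i, U i) (_ : ∀ i, ediamD d (U i) ≤ ε),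
      ∑' i, ediamD d (U i) ^ k

/-- The frontier of `U` is a rectifiable closed curve (for the Hilbert metric of `C`):
it is the image of a closed continuous curve and has finite one-dimensional Hausdorff
measure. -/
def RectCurveBoundary (C U : Set (Euc 2)) : Prop :=
  ∃ c : ℝ → Euc 2, ContinuousOn c (Icc 0 1) ∧ c '' Icc (0 : ℝ) 1 = frontier U ∧
    c 0 = c 1 ∧ hausD 1 (hDist C) (frontier U) < ⊤

/-- The Cheeger constant `I_∞^C(Ω)` in dimension `2`: infimum of
`ν_C(∂U)/μ_C(U)` over open sets `U` with closure contained in `Ω` whose boundary is a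
rectifiable curve, `ν_C` being the `1`-dimensional Hausdorff measure of `(C, d_C)`. -/
def cheeger2D (C Ω : Set (Euc 2)) : ℝ :=
  sInf {r : ℝ | ∃ U : Set (Euc 2), IsOpen U ∧ U.Nonempty ∧ closure U ⊆ Ω ∧
    RectCurveBoundary C U ∧
    r = (hausD 1 (hDist C) (frontier U)).toReal / (hMeasure C U).toReal}

/-- The Cheeger constant `I_∞(C)` of a planar Hilbert geometry. -/
def cheeger2 (C : Set (Euc 2)) : ℝ := cheeger2D C C

/-- `S` is a `C¹` hypersurface: near each of its points it is the zero set of a `C¹`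
function with nonvanishing differential. -/
def IsC1Hypersurface {n : ℕ} (S : Set (Euc n)) : Prop :=
  ∀ x ∈ S, ∃ (f : Euc n → ℝ) (U : Set (Euc n)), U ∈ nhds x ∧ ContDiffOn ℝ 1 f U ∧
    (∀ y ∈ U, fderiv ℝ f y ≠ 0) ∧ S ∩ U = {y ∈ U | f y = 0}

/-- The Cheeger constant `I_∞^C(Ω)` in dimension `n`: infimum of `ν_C(∂U)/μ_C(U)` over
open sets `U` with closure contained in `Ω` whose boundary is a `C¹` hypersurface,
`ν_C` being the `(n-1)`-dimensional Hausdorff measure of `(C, d_C)`. -/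
def cheegerND {n : ℕ} (C Ω : Set (Euc n)) : ℝ :=
  sInf {r : ℝ | ∃ U : Set (Euc n), IsOpen U ∧ U.Nonempty ∧ closure U ⊆ Ω ∧
    IsC1Hypersurface (frontier U) ∧
    r = (hausD ((n : ℝ) - 1) (hDist C) (frontier U)).toReal / (hMeasure C U).toReal}

/-- The boundary of the convex set `C` is of class `C¹`: through each boundary point
passes a unique supporting hyperplane. -/
def HasC1Boundary {n : ℕ} (C : Set (Euc n)) : Prop :=
  ∀ x ∈ frontier C, ∃! l : Euc n →L[ℝ] ℝ, ‖l‖ = 1 ∧ ∀ y ∈ C, l y ≤ l x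

/-- The convex set `C` is strictly convex: the open segment joining two distinct
boundary points is contained in `C`. -/
def IsStrictlyConvexSet {n : ℕ} (C : Set (Euc n)) : Prop :=
  ∀ x ∈ frontier C, ∀ y ∈ frontier C, x ≠ y → openSegment ℝ x y ⊆ C

end

section
open MeasureTheory Set Filter
open scoped ENNReal NNReal

/-- standing assumptions on the domain -/
structure HDom (C : Set (Euc 2)) : Prop where
  conv : Convex ℝ C
  opn : IsOpen C
  bdd : Bornology.IsBounded C

theorem HDom.mix {C : Set (Euc 2)} (h : HDom C) {p c : Euc 2} (hp : p ∈ C) (hc : c ∈ closure C)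
    {a b : ℝ} (ha : 0 < a) (hb : 0 ≤ b) (hab : a + b = 1) : a • p + b • c ∈ C := by
  have := h.conv.combo_interior_closure_mem_interior (by rwa [h.opn.interior_eq]) hc ha hb hab
  rwa [h.opn.interior_eq] at this

theorem HDom.mixcl {C : Set (Euc 2)} (h : HDom C) {p c : Euc 2} (hp : p ∈ closure C)
    (hc : c ∈ closure C)
    {a b : ℝ} (ha : 0 ≤ a) (hb : 0 ≤ b) (hab : a + b = 1) : a • p + b • c ∈ closure C :=
  h.conv.closure hp hc ha hb hab


theorem lp_bdd {C : Set (Euc 2)} (h : HDom C) {p v : Euc 2} (hv : v ≠ 0) 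
    : BddAbove (lineParams C p v) := by
  obtain ⟨R, hR⟩ := h.bdd.subset_closedBall p
  refine ⟨R / ‖v‖, fun t ht => ?_⟩
  have h1 := hR ht
  rw [Metric.mem_closedBall, dist_eq_norm] at h1
  have h2 : ‖t • v‖ ≤ R := by simpa using h1
  rw [norm_smul] at h2
  rw [le_div_iff₀ (norm_pos_iff.2 hv)]
  have := le_abs_self t
  have := norm_nonneg v
  rw [Real.norm_eq_abs] at h2
  nlinarith

theorem lp_open {C : Set (Euc 2)} (h : HDom C) {p v : Euc 2} 
    : IsOpen (lineParams C p v) :=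
  h.opn.preimage (by fun_prop : Continuous fun t : ℝ => p + t • v)

theorem lp_lt {C : Set (Euc 2)} (h : HDom C) {p v : Euc 2} (hv : v ≠ 0) 
    {t : ℝ} (ht : p + t • v ∈ C) : t < sSup (lineParams C p v) := by
  have ho := lp_open h (p := p) (v := v)
  obtain ⟨ε, hε, hb⟩ := Metric.isOpen_iff.1 ho t ht
  have : t + ε / 2 ∈ lineParams C p v := by
    apply hb; rw [Metric.mem_ball, Real.dist_eq]; rw [abs_of_pos] <;> linarith
  have := le_csSup (lp_bdd h hv) this
  linarith

theorem lp_pos {C : Set (Euc 2)} (h : HDom C) {p v : Euc 2} (hp : p ∈ C) (hv : v ≠ 0) 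
    : 0 < sSup (lineParams C p v) := lp_lt h hv (by simpa using hp)

theorem lp_end {C : Set (Euc 2)} (h : HDom C) {p v : Euc 2} (hp : p ∈ C) (hv : v ≠ 0) 
    : p + sSup (lineParams C p v) • v ∈ closure C := by
  have h1 : sSup (lineParams C p v) ∈ closure (lineParams C p v) :=
    csSup_mem_closure ⟨0, by simpa [lineParams] using hp⟩ (lp_bdd h hv)
  have hc : Continuous fun t : ℝ => p + t • v := by fun_prop
  have := map_mem_closure hc h1 (t := C) (fun t ht => ht)
  exact this

theorem lp_mem {C : Set (Euc 2)} (h : HDom C) {p v : Euc 2} (hp : p ∈ C) (hv : v ≠ 0) 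
    {t : ℝ} (h0 : 0 ≤ t) (ht : t < sSup (lineParams C p v)) : p + t • v ∈ C := by
  have hs := lp_pos h hp hv
  have := h.mix hp (lp_end h hp hv) (a := 1 - t / sSup (lineParams C p v))
    (b := t / sSup (lineParams C p v)) (by rw [sub_pos, div_lt_one hs]; exact ht)
    (by positivity) (by ring)
  convert this using 1
  have hh : (t / sSup (lineParams C p v)) * sSup (lineParams C p v) = t := by field_simp
  rw [smul_add, smul_smul, hh]
  module

theorem lp_ge {C : Set (Euc 2)} (h : HDom C) {p v : Euc 2} (hp : p ∈ C) (hv : v ≠ 0) 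
    {t : ℝ} (ht : p + t • v ∈ closure C) : t ≤ sSup (lineParams C p v) := by
  by_contra hlt
  push Not at hlt
  have hs := lp_pos h hp hv
  have ht0 : 0 < t := hs.trans hlt
  have := h.mix hp ht (a := 1 - sSup (lineParams C p v) / t)
    (b := sSup (lineParams C p v) / t) (by rw [sub_pos, div_lt_one ht0]; exact hlt)
    (by positivity) (by ring)
  have h2 : p + sSup (lineParams C p v) • v ∈ C := by
    convert this using 1
    have hh : (sSup (lineParams C p v) / t) * t = sSup (lineParams C p v) := by field_simp
    rw [smul_add, smul_smul, hh]
    module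
  exact lt_irrefl _ (lp_lt h hv h2)

theorem lp_sInf {C : Set (Euc 2)} {p v : Euc 2} 
    : sInf (lineParams C p v) = - sSup (lineParams C p (-v)) := by
  rw [Real.sInf_def]
  congr 2
  ext t
  simp [lineParams]


/-- `q` is reached from `p` with Funk ratio at least `a`. -/
def RR (C : Set (Euc 2)) (p q : Euc 2) (a : ℝ) : Prop :=
  0 < a ∧ a ≤ 1 ∧ ∃ c ∈ closure C, q = a • p + (1 - a) • c

theorem RR.trans {C : Set (Euc 2)} (h : HDom C) {p q r : Euc 2} {a b : ℝ}
    (h1 : RR C p q a) (h2 : RR C q r b) : RR C p r (a * b) := by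
  obtain ⟨ha, ha1, c, hc, rfl⟩ := h1
  obtain ⟨hb, hb1, d, hd, rfl⟩ := h2
  refine ⟨by positivity, by nlinarith, ?_⟩
  rcases eq_or_lt_of_le (by nlinarith : a * b ≤ 1) with hab | hab
  · have : a = 1 := by nlinarith
    have : b = 1 := by nlinarith
    subst_vars
    exact ⟨c, hc, by simp⟩
  · have hp : 0 < 1 - a * b := by linarith
    refine ⟨(b * (1 - a) / (1 - a * b)) • c + ((1 - b) / (1 - a * b)) • d,
      h.mixcl hc hd (div_nonneg (by nlinarith) hp.le) (div_nonneg (by linarith) hp.le) ?_, ?_⟩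
    · rw [← add_div, div_eq_one_iff_eq hp.ne']; ring
    · rw [smul_add (1 - a * b), smul_smul, smul_smul, mul_div_cancel₀ _ hp.ne',
        mul_div_cancel₀ _ hp.ne']
      module

theorem RR.refl {C : Set (Euc 2)} {p : Euc 2} (hp : p ∈ C) : RR C p p 1 :=
  ⟨one_pos, le_rfl, p, subset_closure hp, by simp⟩

theorem RR.mono {C : Set (Euc 2)} (h : HDom C) {p q : Euc 2} (hp : p ∈ C) {a b : ℝ}
    (h1 : RR C p q a) (hb : 0 < b) (hba : b ≤ a) : RR C p q b := by
  obtain ⟨ha, ha1, c, hc, hqe⟩ := h1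
  rcases eq_or_lt_of_le hba with rfl | hlt
  · exact ⟨ha, ha1, c, hc, hqe⟩
  have hpb : 0 < 1 - b := by linarith
  refine ⟨hb, by linarith, ((a - b) / (1 - b)) • p + ((1 - a) / (1 - b)) • c, ?_, ?_⟩
  · refine h.mixcl (subset_closure hp) hc (by apply div_nonneg <;> nlinarith)
      (by apply div_nonneg <;> nlinarith) ?_
    rw [← add_div, div_eq_one_iff_eq hpb.ne']; ring
  · rw [hqe, smul_add (1 - b), smul_smul, smul_smul, mul_div_cancel₀ _ hpb.ne',
        mul_div_cancel₀ _ hpb.ne']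
    module

theorem hDist_eq {C : Set (Euc 2)} (h : HDom C) {p q : Euc 2} (hp : p ∈ C) (hpq : p ≠ q) :
    hDist C p q = (1 / 2) * Real.log
      ((sSup (lineParams C q (p - q)) * sSup (lineParams C p (q - p))) /
        ((sSup (lineParams C q (p - q)) - 1) * (sSup (lineParams C p (q - p)) - 1))) := by
  have : sSup (lineParams C q (p - q)) = 1 - sInf (lineParams C p (q - p)) := by
    have h1 : sSup (lineParams C q (p - q))
        = sSup ((fun x => 1 + x) '' lineParams C p (-(q - p))) := by
      congr 1
      ext t
      constructor
      · intro ht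
        refine ⟨t - 1, ?_, by ring⟩
        change q + t • (p - q) ∈ C at ht
        change p + (t - 1) • -(q - p) ∈ C
        rwa [show p + (t - 1) • -(q - p) = q + t • (p - q) by module]
      · rintro ⟨x, hx, rfl⟩
        change q + (1 + x) • (p - q) ∈ C
        change p + x • -(q - p) ∈ C at hx
        rwa [show q + (1 + x) • (p - q) = p + x • -(q - p) by module]
    rw [h1, lp_sInf, sub_neg_eq_add]
    have hne : (lineParams C p (-(q - p))).Nonempty := ⟨0, by simpa [lineParams] using hp⟩
    have hb : BddAbove (lineParams C p (-(q - p))) :=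
      lp_bdd h (by simpa [sub_eq_zero] using hpq)
    exact ((OrderIso.addLeft (1:ℝ)).map_csSup' hne hb).symm
  rw [hDist, if_neg hpq, this]
  congr 3
  ring

theorem log_ratio {x y : ℝ} (hx : 1 < x) (hy : 1 < y) :
    (1 / 2) * Real.log ((x * y) / ((x - 1) * (y - 1)))
      = -(1 / 2) * (Real.log (1 - 1 / y) + Real.log (1 - 1 / x)) := by
  have h1 : 0 < 1 - 1 / y := by rw [sub_pos, div_lt_one (by linarith)]; exact hy
  have h2 : 0 < 1 - 1 / x := by rw [sub_pos, div_lt_one (by linarith)]; exact hx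
  rw [← Real.log_mul h1.ne' h2.ne', neg_mul, ← mul_neg, ← Real.log_inv]
  congr 2
  have : y - 1 ≠ 0 := by linarith
  have : x - 1 ≠ 0 := by linarith
  field_simp

theorem hDist_le {C : Set (Euc 2)} (h : HDom C) {p q : Euc 2} (hp : p ∈ C) (hq : q ∈ C) {a b : ℝ}
    (h1 : RR C p q a) (h2 : RR C q p b) :
    hDist C p q ≤ -(1 / 2) * (Real.log a + Real.log b) := by
  have key : ∀ {p q : Euc 2} {a : ℝ}, p ∈ C → p ≠ q → RR C p q a →
      a ≤ 1 - 1 / sSup (lineParams C p (q - p)) := by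
    intro p q a hp hpq ⟨ha, ha1, c, hc, hqe⟩
    have hv : q - p ≠ 0 := by simpa [sub_eq_zero] using hpq.symm
    have ha2 : a < 1 := by
      rcases eq_or_lt_of_le ha1 with rfl | hlt
      · exact absurd (by simpa using hqe.symm) hpq
      · exact hlt
    have ha3 : 0 < 1 - a := by linarith
    have : (1 / (1 - a)) ≤ sSup (lineParams C p (q - p)) := by
      apply lp_ge h hp hv
      convert hc using 1
      rw [hqe, show a • p + (1 - a) • c - p = (1 - a) • (c - p) by module, smul_smul]
      field_simp
      module
    have h4 := one_div_le_one_div_of_le (by positivity) this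
    rw [one_div_one_div] at h4
    linarith
  have hs1 := h1
  have hs2 := h2
  obtain ⟨ha, ha1, -⟩ := h1
  obtain ⟨hb, hb1, -⟩ := h2
  by_cases hpq : p = q
  · rw [hDist, if_pos hpq]
    have := Real.log_nonpos ha.le ha1
    have := Real.log_nonpos hb.le hb1
    linarith
  · have hv : q - p ≠ 0 := by simpa [sub_eq_zero] using Ne.symm hpq
    have hv' : p - q ≠ 0 := by simpa [sub_eq_zero] using hpq
    rw [hDist_eq h hp hpq, log_ratio (lp_lt h hv' (by simpa using hp)) (lp_lt h hv (by simpa using hq))]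
    have k1 := Real.log_le_log ha (key hp hpq hs1)
    have k2 := Real.log_le_log hb (key hq (Ne.symm hpq) hs2)
    linarith

theorem hDist_ex {C : Set (Euc 2)} (h : HDom C) {p q : Euc 2} (hp : p ∈ C) (hq : q ∈ C) :
    ∃ a b : ℝ, RR C p q a ∧ RR C q p b ∧ hDist C p q = -(1 / 2) * (Real.log a + Real.log b) := by
  by_cases hpq : p = q
  · subst hpq
    exact ⟨1, 1, RR.refl hp, RR.refl hp, by simp [hDist]⟩
  · have key : ∀ {p q : Euc 2}, p ∈ C → q ∈ C → p ≠ q →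
        RR C p q (1 - 1 / sSup (lineParams C p (q - p))) := by
      intro p q hp hq hpq
      have hv : q - p ≠ 0 := by simpa [sub_eq_zero] using hpq.symm
      have h1 := lp_lt h hv (p := p) (t := 1) (by simpa using hq)
      refine ⟨by rw [sub_pos, div_lt_one (by linarith)]; exact h1,
        by rw [sub_le_self_iff]; positivity, _, lp_end h hp hv, ?_⟩
      rw [sub_sub_cancel, smul_add, smul_smul, one_div_mul_cancel (by linarith)]
      module
    have hv : q - p ≠ 0 := by simpa [sub_eq_zero] using Ne.symm hpq
    have hv' : p - q ≠ 0 := by simpa [sub_eq_zero] using hpq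
    refine ⟨_, _, key hp hq hpq, key hq hp (Ne.symm hpq), ?_⟩
    rw [hDist_eq h hp hpq, log_ratio (lp_lt h hv' (by simpa using hp)) (lp_lt h hv (by simpa using hq))]

theorem hDist_nonneg {C : Set (Euc 2)} (h : HDom C) {p q : Euc 2} (hp : p ∈ C) (hq : q ∈ C) :
    0 ≤ hDist C p q := by
  obtain ⟨a, b, ⟨ha, ha1, -⟩, ⟨hb, hb1, -⟩, he⟩ := hDist_ex h hp hq
  have := Real.log_nonpos ha.le ha1
  have := Real.log_nonpos hb.le hb1
  linarith

theorem hDist_comm {C : Set (Euc 2)} (h : HDom C) {p q : Euc 2} (hp : p ∈ C) (hq : q ∈ C) :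
    hDist C p q = hDist C q p := by
  have key : ∀ {p q : Euc 2}, p ∈ C → q ∈ C → hDist C p q ≤ hDist C q p := by
    intro p q hp hq
    obtain ⟨a, b, h1, h2, he⟩ := hDist_ex h hq hp
    have := hDist_le h hp hq h2 h1
    linarith
  exact le_antisymm (key hp hq) (key hq hp)

theorem hDist_tri {C : Set (Euc 2)} (h : HDom C) {p q r : Euc 2} (hp : p ∈ C) (hq : q ∈ C)
    (hr : r ∈ C) : hDist C p r ≤ hDist C p q + hDist C q r := by
  obtain ⟨a, b, h1, h2, he⟩ := hDist_ex h hp hq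
  obtain ⟨a', b', h1', h2', he'⟩ := hDist_ex h hq hr
  have := hDist_le h hp hr (h1.trans h h1') (h2'.trans h h2)
  rw [Real.log_mul h1.1.ne' h1'.1.ne', Real.log_mul h2'.1.ne' h2.1.ne'] at this
  linarith

/-- additivity along segments -/
theorem hDist_add {C : Set (Euc 2)} (h : HDom C) {p r : Euc 2} (hp : p ∈ C)
    (hr : r ∈ C) {t : ℝ} (ht0 : 0 ≤ t) (ht1 : t ≤ 1) :
    hDist C p ((1 - t) • p + t • r) + hDist C ((1 - t) • p + t • r) r ≤ hDist C p r := by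
  have key : ∀ {p r : Euc 2} {a t : ℝ}, 0 ≤ t → t ≤ 1 → RR C p r a →
      ∃ a1 a2, RR C p ((1 - t) • p + t • r) a1 ∧ RR C ((1 - t) • p + t • r) r a2 ∧
        Real.log a = Real.log a1 + Real.log a2 := by
    intro p r a t ht0 ht1 ⟨ha, ha1, c, hc, hr⟩
    have hpos : 0 < 1 - t * (1 - a) := by nlinarith
    refine ⟨1 - t * (1 - a), a / (1 - t * (1 - a)), ⟨hpos, by nlinarith, c, hc, ?_⟩,
      ⟨by positivity, by rw [div_le_one hpos]; nlinarith, c, hc, ?_⟩, ?_⟩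
    · rw [hr]; module
    · have e1 : (1 - t) • p + t • r = (1 - t * (1 - a)) • p + (t * (1 - a)) • c := by
        rw [hr]; module
      have e2 : (1 - a / (1 - t * (1 - a))) = (1 - a) - (a / (1 - t * (1 - a))) * (t * (1 - a)) := by
        field_simp; ring
      rw [e1, smul_add, smul_smul, smul_smul, div_mul_cancel₀ _ hpos.ne', e2, hr]
      module
    · rw [Real.log_div ha.ne' hpos.ne']; ring
  obtain ⟨a, b, h1, h2, he⟩ := hDist_ex h hp hr
  obtain ⟨a1, a2, k1, k2, k3⟩ := key ht0 ht1 h1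
  obtain ⟨b1, b2, l1, l2, l3⟩ := key (t := 1 - t) (by linarith) (by linarith) h2
  have hm : (1 - (1 - t)) • r + (1 - t) • p = (1 - t) • p + t • r := by module
  rw [hm] at l1 l2
  have hmC : (1 - t) • p + t • r ∈ C := h.conv hp hr (by linarith) ht0 (by ring)
  have := hDist_le h hp hmC k1 l2
  have := hDist_le h hmC hr k2 l1
  rw [he, k3, l3]
  linarith

end

section
open MeasureTheory Set Filter
open scoped ENNReal NNReal

/-- symmetrised domain at `p` -/
def SS (C : Set (Euc 2)) (p : Euc 2) : Set (Euc 2) := {u | p + u ∈ C ∧ p - u ∈ C}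

/-- planar determinant -/
def det2 (u v : Euc 2) : ℝ := u 0 * v 1 - u 1 * v 0

theorem det2_add (u v w : Euc 2) : det2 u (v + w) = det2 u v + det2 u w := by
  simp [det2]; ring
theorem det2_smul (u v : Euc 2) (a : ℝ) : det2 u (a • v) = a * det2 u v := by
  simp [det2]; ring
theorem det2_neg (u v : Euc 2) : det2 u (-v) = - det2 u v := by
  simp [det2]; ring
theorem det2_sub (u v w : Euc 2) : det2 u (v - w) = det2 u v - det2 u w := by
  simp [det2]; ring
theorem det2_self (u : Euc 2) : det2 u u = 0 := by
  simp [det2]; ring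
theorem det2_swap (u v : Euc 2) : det2 u v = - det2 v u := by
  simp [det2]; ring

theorem det2_decomp {e w : Euc 2} (h : det2 e w ≠ 0) (v : Euc 2) :
    v = (det2 v w / det2 e w) • e + (det2 e v / det2 e w) • w := by
  have h' : e 0 * w 1 - e 1 * w 0 ≠ 0 := h
  ext i
  fin_cases i
  · simp [det2]; rw [div_mul_eq_mul_div, div_mul_eq_mul_div, ← add_div, eq_div_iff h']; ring
  · simp [det2]; rw [div_mul_eq_mul_div, div_mul_eq_mul_div, ← add_div, eq_div_iff h']; ring

theorem det2_bound (u v : Euc 2) : |det2 u v| ≤ 2 * ‖u‖ * ‖v‖ := by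
  have h0 := PiLp.norm_apply_le u 0
  have h1 := PiLp.norm_apply_le u 1
  have k0 := PiLp.norm_apply_le v 0
  have k1 := PiLp.norm_apply_le v 1
  simp only [Real.norm_eq_abs] at h0 h1 k0 k1
  unfold det2
  calc |u 0 * v 1 - u 1 * v 0| ≤ |u 0 * v 1| + |u 1 * v 0| := abs_sub _ _
    _ = |u 0| * |v 1| + |u 1| * |v 0| := by rw [abs_mul, abs_mul]
    _ ≤ ‖u‖ * ‖v‖ + ‖u‖ * ‖v‖ := by gcongr
    _ = _ := by ring

theorem SS.neg {C : Set (Euc 2)} {p u : Euc 2} (h : u ∈ SS C p) : -u ∈ SS C p :=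
  ⟨by simpa [← sub_eq_add_neg] using h.2, by simpa using h.1⟩

theorem SS_conv {C : Set (Euc 2)} (h : HDom C) {p : Euc 2} : Convex ℝ (SS C p) := by
  intro u hu v hv a b ha hb hab
  constructor
  · have := h.conv hu.1 hv.1 ha hb hab
    convert this using 1
    have : p = (a + b) • p := by rw [hab, one_smul]
    nth_rewrite 1 [this]; module
  · have := h.conv hu.2 hv.2 ha hb hab
    convert this using 1
    have : p = (a + b) • p := by rw [hab, one_smul]
    nth_rewrite 1 [this]; module

theorem SS_zero {C : Set (Euc 2)} {p : Euc 2} (hp : p ∈ C) : (0 : Euc 2) ∈ SS C p :=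
  ⟨by simpa, by simpa⟩

/-- absolutely convex -/
theorem SS_comb {C : Set (Euc 2)} (h : HDom C) {p : Euc 2} (hp : p ∈ C) {u v : Euc 2}
    (hu : u ∈ SS C p) (hv : v ∈ SS C p) {a b : ℝ} (hab : |a| + |b| ≤ 1) :
    a • u + b • v ∈ SS C p := by
  have key : ∀ {u : Euc 2} {a : ℝ}, u ∈ SS C p → ∃ u' ∈ SS C p, a • u = |a| • u' := by
    intro u a hu
    rcases abs_cases a with ⟨h1, _⟩ | ⟨h1, _⟩
    · exact ⟨u, hu, by rw [h1]⟩
    · exact ⟨-u, SS.neg hu, by rw [h1]; simp⟩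
  obtain ⟨u', hu', e1⟩ := key (a := a) hu
  obtain ⟨v', hv', e2⟩ := key (a := b) hv
  rw [e1, e2]
  have hz := SS_zero hp
  have ha := abs_nonneg a
  have hb := abs_nonneg b
  rcases eq_or_lt_of_le (add_nonneg ha hb) with h0 | h0
  · have : |a| = 0 := by linarith
    have h2 : |b| = 0 := by linarith
    rw [this, h2]; simpa using hz
  · have k := SS_conv h hu' hv' (a := |a| / (|a| + |b|)) (b := |b| / (|a| + |b|))
      (by positivity) (by positivity) (by rw [← add_div, div_self h0.ne'])
    have k2 := SS_conv h k hz h0.le (by linarith : 0 ≤ 1 - (|a| + |b|)) (by ring)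
    convert k2 using 1
    rw [smul_add, smul_smul, smul_smul, mul_div_cancel₀ _ h0.ne', mul_div_cancel₀ _ h0.ne']
    simp

theorem SS_smul {C : Set (Euc 2)} (h : HDom C) {p : Euc 2} (hp : p ∈ C) {u : Euc 2}
    (hu : u ∈ SS C p) {a : ℝ} (ha : |a| ≤ 1) : a • u ∈ SS C p := by
  have := SS_comb h hp hu hu (a := a) (b := 0) (by simpa using ha)
  simpa using this

theorem SS_open {C : Set (Euc 2)} (h : HDom C) {p : Euc 2} : IsOpen (SS C p) :=
  (h.opn.preimage (by fun_prop : Continuous fun u : Euc 2 => p + u)).inter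
    (h.opn.preimage (by fun_prop : Continuous fun u : Euc 2 => p - u))

/-- `d ≤ log 2` criterion -/
theorem hDist_half {C : Set (Euc 2)} (h : HDom C) {p q : Euc 2} (hp : p ∈ C)
    (hu : (2:ℝ) • (q - p) ∈ SS C p) : q ∈ C ∧ hDist C p q ≤ Real.log 2 := by
  have h2 := SS_smul h hp hu (a := 1/2) (by norm_num [abs_of_pos])
  rw [smul_smul] at h2
  norm_num at h2
  have hq : q ∈ C := by simpa using h2.1
  refine ⟨hq, ?_⟩
  have r1 : RR C p q (1/2) := ⟨by norm_num, by norm_num, _, subset_closure hu.1, by module⟩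
  have r2 : RR C q p (1/2) := ⟨by norm_num, by norm_num, _, subset_closure h2.2, by module⟩
  have := hDist_le h hp hq r1 r2
  rw [show Real.log (1/2) = - Real.log 2 by rw [one_div, Real.log_inv]] at this
  linarith

theorem SS_sub_TB {C : Set (Euc 2)} (h : HDom C) {p : Euc 2} (_hp : p ∈ C) :
    SS C p ⊆ tangentBall C p 1 := by
  intro u hu
  change fNorm C p u < 1
  unfold fNorm
  split_ifs with h0
  · norm_num
  have h1 := lp_lt h h0 (p := p) (t := 1) (by simpa using hu.1)
  have h2 := lp_lt h (neg_ne_zero.2 h0) (p := p) (t := 1) (by simpa [← sub_eq_add_neg] using hu.2)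
  rw [lp_sInf, one_div_neg_eq_neg_one_div]
  have k1 : 1 / sSup (lineParams C p u) < 1 := by rw [div_lt_one (by linarith)]; exact h1
  have k2 : 1 / sSup (lineParams C p (-u)) < 1 := by rw [div_lt_one (by linarith)]; exact h2
  linarith

theorem TB_sub_SS {C : Set (Euc 2)} (h : HDom C) {p : Euc 2} (hp : p ∈ C) {u : Euc 2}
    (hu : u ∈ tangentBall C p 1) : (1/2:ℝ) • u ∈ SS C p := by
  change fNorm C p u < 1 at hu
  unfold fNorm at hu
  split_ifs at hu with h0
  · rw [h0]; simpa using SS_zero hp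
  rw [lp_sInf, one_div_neg_eq_neg_one_div] at hu
  have p1 := lp_pos h hp h0
  have p2 := lp_pos h hp (neg_ne_zero.2 h0)
  have q1 : 0 < 1 / sSup (lineParams C p u) := by positivity
  have q2 : 0 < 1 / sSup (lineParams C p (-u)) := by positivity
  have k1 : 1/2 < sSup (lineParams C p u) := by
    have : 1 / sSup (lineParams C p u) < 2 := by linarith
    rw [div_lt_iff₀ p1] at this; linarith
  have k2 : 1/2 < sSup (lineParams C p (-u)) := by
    have : 1 / sSup (lineParams C p (-u)) < 2 := by linarith
    rw [div_lt_iff₀ p2] at this; linarith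
  refine ⟨lp_mem h hp h0 (by norm_num) k1, ?_⟩
  have := lp_mem h hp (neg_ne_zero.2 h0) (by norm_num) k2
  rwa [smul_neg, ← sub_eq_add_neg] at this

open scoped Pointwise in
theorem vol_TB_le {C : Set (Euc 2)} (h : HDom C) {p : Euc 2} (hp : p ∈ C) :
    volume (tangentBall C p 1) ≤ 4 * volume (SS C p) := by
  have : tangentBall C p 1 ⊆ (2:ℝ) • SS C p := by
    intro u hu
    exact ⟨_, TB_sub_SS h hp hu, by simp [smul_smul]⟩
  refine (measure_mono this).trans ?_
  rw [Measure.addHaar_smul]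
  simp
  norm_num

theorem SS_bdd {C : Set (Euc 2)} (h : HDom C) {p : Euc 2} : Bornology.IsBounded (SS C p) := by
  obtain ⟨R, hR⟩ := h.bdd.subset_closedBall p
  refine (Metric.isBounded_closedBall (x := (0 : Euc 2)) (r := R)).subset fun u hu => ?_
  have := hR hu.1
  simpa [dist_eq_norm] using this

theorem vol_SS_lt {C : Set (Euc 2)} (h : HDom C) {p : Euc 2} : volume (SS C p) < ⊤ :=
  (SS_bdd h).measure_lt_top

theorem vol_TB_lt {C : Set (Euc 2)} (h : HDom C) {p : Euc 2} (hp : p ∈ C) :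
    volume (tangentBall C p 1) < ⊤ :=
  (vol_TB_le h hp).trans_lt (ENNReal.mul_lt_top (by simp) (vol_SS_lt h))

theorem vol_SS_pos {C : Set (Euc 2)} (h : HDom C) {p : Euc 2} (hp : p ∈ C) :
    0 < volume (SS C p) := (SS_open h).measure_pos _ ⟨0, SS_zero hp⟩

theorem omega_pos : 0 < omegaVol 2 :=
  ENNReal.toReal_pos (Metric.measure_ball_pos _ _ one_pos).ne' measure_ball_lt_top.ne

/-- density -/
noncomputable def dens (C : Set (Euc 2)) (p : Euc 2) : ℝ≥0∞ :=
  ENNReal.ofReal (omegaVol 2 / (volume (tangentBall C p 1)).toReal)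

theorem dens_le {C : Set (Euc 2)} (h : HDom C) {p : Euc 2} (hp : p ∈ C) {v : ℝ} (hv : 0 < v)
    (hS : ENNReal.ofReal v ≤ volume (SS C p)) : dens C p ≤ ENNReal.ofReal (omegaVol 2 / v) := by
  apply ENNReal.ofReal_le_ofReal
  have h1 : ENNReal.ofReal v ≤ volume (tangentBall C p 1) :=
    hS.trans (measure_mono (SS_sub_TB h hp))
  have h2 : v ≤ (volume (tangentBall C p 1)).toReal :=
    (ENNReal.ofReal_le_iff_le_toReal (vol_TB_lt h hp).ne).1 h1
  have := omega_pos
  gcongr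

theorem dens_ge {C : Set (Euc 2)} (h : HDom C) {p : Euc 2} (hp : p ∈ C) {v : ℝ} (hv : 0 < v)
    (hS : volume (SS C p) ≤ ENNReal.ofReal v) :
    ENNReal.ofReal (omegaVol 2 / (4 * v)) ≤ dens C p := by
  apply ENNReal.ofReal_le_ofReal
  have h1 : volume (tangentBall C p 1) ≤ ENNReal.ofReal (4 * v) := by
    refine (vol_TB_le h hp).trans ?_
    rw [ENNReal.ofReal_mul (by norm_num)]
    gcongr
    simp
  have h2 : (volume (tangentBall C p 1)).toReal ≤ 4 * v :=
    ENNReal.toReal_le_of_le_ofReal (by positivity) h1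
  have h3 : 0 < (volume (tangentBall C p 1)).toReal :=
    ENNReal.toReal_pos ((vol_SS_pos h hp).trans_le (measure_mono (SS_sub_TB h hp))).ne'
      (vol_TB_lt h hp).ne
  have := omega_pos
  gcongr

theorem hM_le {C A : Set (Euc 2)} (h : HDom C) (hA : MeasurableSet A) {M : ℝ≥0∞}
    (hd : ∀ p ∈ A, p ∈ C → dens C p ≤ M) : hMeasure C A ≤ M * volume A := by
  unfold hMeasure
  rw [withDensity_apply _ hA, Measure.restrict_restrict hA]
  calc ∫⁻ a in A ∩ C, dens C a ≤ ∫⁻ a in A ∩ C, M :=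
        setLIntegral_mono' (hA.inter h.opn.measurableSet) fun x hx => hd x hx.1 hx.2
    _ = M * volume (A ∩ C) := by rw [setLIntegral_const]
    _ ≤ _ := by gcongr; exact inter_subset_left

theorem hM_ge {C A : Set (Euc 2)} (hA : MeasurableSet A) (hAC : A ⊆ C) {M : ℝ≥0∞}
    (hd : ∀ p ∈ A, M ≤ dens C p) : M * volume A ≤ hMeasure C A := by
  unfold hMeasure
  rw [withDensity_apply _ hA, Measure.restrict_restrict hA, inter_eq_left.2 hAC]
  calc M * volume A = ∫⁻ a in A, M := by rw [setLIntegral_const]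
    _ ≤ _ := setLIntegral_mono' hA fun x hx => hd x hx

theorem vol_par (c v1 v2 : Euc 2) (I J : Set ℝ) :
    volume ((fun z : ℝ × ℝ => c + z.1 • v1 + z.2 • v2) '' (I ×ˢ J)) =
      ENNReal.ofReal |det2 v1 v2| * (volume I * volume J) := by
  let L : Euc 2 →ₗ[ℝ] Euc 2 :=
    { toFun := fun x => x 0 • v1 + x 1 • v2
      map_add' := by intro x y; simp; module
      map_smul' := by intro a x; simp; module }
  have hdet : LinearMap.det L = det2 v1 v2 := by
    rw [← LinearMap.det_toMatrix (EuclideanSpace.basisFun (Fin 2) ℝ).toBasis, Matrix.det_fin_two]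
    simp [LinearMap.toMatrix_apply, L, det2]
    try ring
  let f : ℝ × ℝ → Euc 2 := fun z => !₂[z.1, z.2]
  have hS : volume (f '' (I ×ˢ J)) = volume I * volume J := by
    let E : ℝ × ℝ ≃ᵐ Euc 2 := (MeasurableEquiv.finTwoArrow (α := ℝ)).symm.trans
      (MeasurableEquiv.toLp 2 (Fin 2 → ℝ))
    have hE : MeasurePreserving E volume volume :=
      (volume_preserving_finTwoArrow ℝ).symm.trans
        (EuclideanSpace.volume_preserving_symm_measurableEquiv_toLp (Fin 2)).symm
    have : f = E := by
      funext z; rfl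
    rw [this, MeasurableEquiv.image_eq_preimage_symm,
      hE.symm.measure_preimage_equiv]
    exact Measure.prod_prod I J
  have : (fun z : ℝ × ℝ => c + z.1 • v1 + z.2 • v2) '' (I ×ˢ J) =
      (fun y => c + y) '' (L '' (f '' (I ×ˢ J))) := by
    rw [image_image, image_image]
    apply image_congr
    intro z _
    simp [L, f, add_assoc]
  rw [this, image_add_left, measure_preimage_add, Measure.addHaar_image_linearMap, hdet, hS]

end

section
open MeasureTheory Set Filter
open scoped ENNReal NNReal

/-- context: base point and inner/outer radii -/
structure Ctx (C : Set (Euc 2)) (o : Euc 2) (r0 R0 : ℝ) : Prop where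
  dom : HDom C
  r0pos : 0 < r0
  hin : ∀ u : Euc 2, ‖u‖ < r0 → o + u ∈ C
  hout : ∀ u : Euc 2, o + u ∈ closure C → ‖u‖ ≤ R0

theorem ctx_exists {C : Set (Euc 2)} (h : HDom C) (hne : C.Nonempty) :
    ∃ o r0 R0, Ctx C o r0 R0 := by
  obtain ⟨o, ho⟩ := hne
  obtain ⟨r, hr, hb⟩ := Metric.isOpen_iff.1 h.opn o ho
  obtain ⟨R, hR⟩ := h.bdd.closure.subset_closedBall o
  refine ⟨o, r, R, h, hr, fun u hu => hb ?_, fun u hu => ?_⟩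
  · simpa [dist_eq_norm] using hu
  · simpa [dist_eq_norm] using hR hu

theorem Ctx.ho {C : Set (Euc 2)} {o : Euc 2} {r0 R0 : ℝ} (c : Ctx C o r0 R0) : o ∈ C := by
  have := c.hin 0 (by simpa using c.r0pos)
  simpa using this

/-- boundary vector -/
structure BV (C : Set (Euc 2)) (o e : Euc 2) : Prop where
  out : o + e ∉ C
  cl : o + e ∈ closure C

/-- radial point -/
noncomputable def qq (o e : Euc 2) (s : ℝ) : Euc 2 := o + (1 - s) • e

section
variable {C : Set (Euc 2)} {o : Euc 2} {r0 R0 : ℝ}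

theorem BV.le1 (c : Ctx C o r0 R0) {e : Euc 2} (b : BV C o e) {μ : ℝ}
    (h : o + μ • e ∈ closure C) : μ ≤ 1 := by
  by_contra hlt
  push Not at hlt
  apply b.out
  have hm : 0 < μ := by linarith
  have := c.dom.mix c.ho h (a := 1 - 1 / μ) (b := 1 / μ) (by rw [sub_pos, div_lt_one hm]; exact hlt)
    (by positivity) (by ring)
  convert this using 1
  rw [smul_add, smul_smul, one_div_mul_cancel hm.ne']
  module

theorem BV.lt1 (c : Ctx C o r0 R0) {e : Euc 2} (b : BV C o e) {μ : ℝ}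
    (h : o + μ • e ∈ C) : μ < 1 := by
  rcases eq_or_lt_of_le (b.le1 c (subset_closure h)) with h1 | h1
  · subst h1; exact absurd (by simpa using h) b.out
  · exact h1

theorem BV.norm_ge (c : Ctx C o r0 R0) {e : Euc 2} (b : BV C o e) : r0 ≤ ‖e‖ := by
  by_contra hlt
  push Not at hlt
  exact b.out (c.hin e hlt)

theorem BV.norm_le (c : Ctx C o r0 R0) {e : Euc 2} (b : BV C o e) : ‖e‖ ≤ R0 := c.hout e b.cl

theorem BV.ne0 (c : Ctx C o r0 R0) {e : Euc 2} (b : BV C o e) : e ≠ 0 :=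
  norm_pos_iff.1 (c.r0pos.trans_le (b.norm_ge c))

theorem BV.mem (c : Ctx C o r0 R0) {e : Euc 2} (b : BV C o e) {s : ℝ} (h0 : 0 < s)
    (h1 : s ≤ 1) : qq o e s ∈ C := by
  have := c.dom.mix c.ho b.cl h0 (by linarith : 0 ≤ 1 - s) (by ring)
  convert this using 1
  unfold qq; module

theorem BV.ne : ∀ {v : Euc 2} (_ : Ctx C o r0 R0) (_ : v ≠ 0), ∃ T : ℝ, 0 < T ∧ BV C o (T • v) := by
  intro v c hv
  refine ⟨_, lp_pos c.dom c.ho hv, fun hh => ?_, lp_end c.dom c.ho hv⟩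
  exact lt_irrefl _ (lp_lt c.dom hv hh)

theorem param (c : Ctx C o r0 R0) {x : Euc 2} (hx : x ∈ C) :
    ∃ e s, BV C o e ∧ 0 < s ∧ s ≤ 1 ∧ x = qq o e s := by
  by_cases hxo : x = o
  · obtain ⟨v, hv⟩ := exists_ne (0 : Euc 2)
    obtain ⟨T, hT, hb⟩ := BV.ne c hv
    exact ⟨_, 1, hb, one_pos, le_rfl, by simp [qq, hxo]⟩
  · have hv : x - o ≠ 0 := sub_ne_zero.2 hxo
    have h1 := lp_lt c.dom hv (p := o) (t := 1) (by simpa using hx)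
    have hb : BV C o (sSup (lineParams C o (x - o)) • (x - o)) :=
      ⟨fun hh => lt_irrefl _ (lp_lt c.dom hv hh), lp_end c.dom c.ho hv⟩
    refine ⟨_, 1 - 1 / sSup (lineParams C o (x - o)), hb,
      by rw [sub_pos, div_lt_one (by linarith)]; exact h1, ?_, ?_⟩
    · rw [sub_le_self_iff]; positivity
    · unfold qq
      rw [sub_sub_cancel, smul_smul, one_div_mul_cancel (by linarith)]
      module

theorem r0R0 (c : Ctx C o r0 R0) : 0 < R0 := by
  obtain ⟨v, hv⟩ := exists_ne (0 : Euc 2)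
  obtain ⟨T, hT, hb⟩ := BV.ne c hv
  exact c.r0pos.trans_le ((hb.norm_ge c).trans (hb.norm_le c))

theorem r0leR0 (c : Ctx C o r0 R0) : r0 ≤ R0 := by
  obtain ⟨v, hv⟩ := exists_ne (0 : Euc 2)
  obtain ⟨T, hT, hb⟩ := BV.ne c hv
  exact ((hb.norm_ge c).trans (hb.norm_le c))

theorem SS_norm (c : Ctx C o r0 R0) {p u : Euc 2} (hu : u ∈ SS C p) : ‖u‖ ≤ R0 := by
  have h1 := c.hout (p + u - o) (by simpa using subset_closure hu.1)
  have h2 := c.hout (p - u - o) (by simpa using subset_closure hu.2)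
  have h3 : (2:ℝ) • u = (p + u - o) - (p - u - o) := by module
  have h4 := norm_sub_le (p + u - o) (p - u - o)
  rw [← h3, norm_smul, Real.norm_eq_abs, abs_of_pos two_pos] at h4
  linarith

/-- half-width in the direction transverse to `e` -/
noncomputable def WW (C : Set (Euc 2)) (o e : Euc 2) (s : ℝ) : ℝ :=
  sSup (det2 e '' SS C (qq o e s))

theorem WW_bdd (c : Ctx C o r0 R0) (e p : Euc 2) : BddAbove (det2 e '' SS C p) := by
  refine ⟨2 * ‖e‖ * R0, ?_⟩
  rintro _ ⟨u, hu, rfl⟩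
  refine (le_abs_self _).trans ((det2_bound e u).trans ?_)
  have := SS_norm c hu
  gcongr

theorem WW_ge (c : Ctx C o r0 R0) {e u : Euc 2} {s : ℝ} (hu : u ∈ SS C (qq o e s)) :
    |det2 e u| ≤ WW C o e s := by
  rw [abs_le]
  constructor
  · have := le_csSup (WW_bdd c e (qq o e s)) ⟨-u, SS.neg hu, rfl⟩
    rw [det2_neg] at this
    unfold WW; linarith
  · exact le_csSup (WW_bdd c e (qq o e s)) ⟨u, hu, rfl⟩

theorem WW_pos (c : Ctx C o r0 R0) {e : Euc 2} (b : BV C o e) {s : ℝ} (h0 : 0 < s)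
    (h1 : s ≤ 1) : 0 < WW C o e s := by
  have hq := b.mem c h0 h1
  obtain ⟨ε, hε, hb⟩ := Metric.isOpen_iff.1 (SS_open c.dom (p := qq o e s)) 0 (SS_zero hq)
  let v : Euc 2 := !₂[-e 1, e 0]
  have hd : 0 < det2 e v := by
    have : det2 e v = ‖e‖ ^ 2 := by
      rw [EuclideanSpace.norm_sq_eq]; simp [det2, v]; ring
    rw [this]
    have := norm_pos_iff.2 (b.ne0 c)
    positivity
  have hv0 : 0 < ‖v‖ + 1 := by positivity
  have : (ε / (‖v‖ + 1)) • v ∈ SS C (qq o e s) := by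
    apply hb
    rw [mem_ball_zero_iff, norm_smul, Real.norm_eq_abs, abs_of_pos (by positivity),
      div_mul_eq_mul_div, div_lt_iff₀ hv0]
    nlinarith
  have h2 := WW_ge c this
  rw [det2_smul, abs_of_pos (by positivity)] at h2
  exact lt_of_lt_of_le (by positivity) h2

theorem WW_ex (c : Ctx C o r0 R0) {e : Euc 2} (b : BV C o e) {s : ℝ} (h0 : 0 < s)
    (h1 : s ≤ 1) {a : ℝ} (ha : a < WW C o e s) : ∃ u ∈ SS C (qq o e s), a < det2 e u := by
  have hne : (det2 e '' SS C (qq o e s)).Nonempty := ⟨_, 0, SS_zero (b.mem c h0 h1), rfl⟩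
  obtain ⟨_, ⟨u, hu, rfl⟩, h2⟩ := exists_lt_of_lt_csSup hne ha
  exact ⟨u, hu, h2⟩

theorem WW_mono (c : Ctx C o r0 R0) {e : Euc 2} (b : BV C o e) {s s' : ℝ} (h0 : 0 < s)
    (hs : s ≤ s') (h1 : s' ≤ 1) : r0 / (2 * R0) * WW C o e s ≤ WW C o e s' := by
  have hr := c.r0pos
  have hR := r0R0 c
  have hrR := r0leR0 c
  have hc : r0 / (2 * R0) ≤ 1 := by rw [div_le_one (by positivity)]; linarith
  have hc0 : 0 < r0 / (2 * R0) := by positivity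
  rcases eq_or_lt_of_le hs with rfl | hlt
  · have := WW_pos c b h0 h1
    nlinarith
  rw [← le_div_iff₀' hc0]
  refine csSup_le (Set.Nonempty.image _ ⟨0, SS_zero (b.mem c h0 (by linarith))⟩) ?_
  rintro _ ⟨u, hu, rfl⟩
  rw [le_div_iff₀' hc0]
  have hs1 : 0 < 1 - s := by linarith
  set l := (1 - s') / (1 - s) with hl
  have hl0 : 0 ≤ l := div_nonneg (by linarith) hs1.le
  have hl1 : l ≤ 1 := by rw [hl, div_le_one hs1]; linarith
  have hls : l * (1 - s) = 1 - s' := by rw [hl]; field_simp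
  have hw : ∀ v : Euc 2, ‖v‖ ≤ R0 → o + (r0 / (2 * R0)) • v ∈ C := by
    intro v hv
    apply c.hin
    rw [norm_smul, Real.norm_eq_abs, abs_of_pos hc0]
    calc r0 / (2 * R0) * ‖v‖ ≤ r0 / (2 * R0) * R0 := by gcongr
      _ = r0 / 2 := by field_simp
      _ < r0 := by linarith
  have hun := SS_norm c hu
  have hmem : (l + (1 - l) * (r0 / (2 * R0))) • u ∈ SS C (qq o e s') := by
    constructor
    · have := c.dom.conv hu.1 (hw u hun) hl0 (by linarith : 0 ≤ 1 - l) (by ring)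
      convert this using 1
      unfold qq
      rw [← hls]; module
    · have := c.dom.conv hu.2 (hw (-u) (by simpa using hun)) hl0 (by linarith : 0 ≤ 1 - l) (by ring)
      convert this using 1
      unfold qq
      rw [← hls]; module
  have := WW_ge c hmem
  rw [det2_smul, abs_mul] at this
  have h3 : r0 / (2 * R0) ≤ |l + (1 - l) * (r0 / (2 * R0))| := by
    refine le_trans ?_ (le_abs_self _)
    nlinarith
  calc r0 / (2 * R0) * det2 e u ≤ r0 / (2 * R0) * |det2 e u| := by gcongr; exact le_abs_self _
    _ ≤ |l + (1 - l) * (r0 / (2 * R0))| * |det2 e u| := by gcongr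
    _ ≤ _ := this

theorem WW_scale (c : Ctx C o r0 R0) {e : Euc 2} (b : BV C o e) {s l : ℝ} (h0 : 0 < s)
    (h1 : s ≤ 1) (hl : 0 < l) (hl1 : l ≤ 1) : l * WW C o e s ≤ WW C o e (l * s) := by
  rw [← le_div_iff₀' hl]
  refine csSup_le (Set.Nonempty.image _ ⟨0, SS_zero (b.mem c h0 (by linarith))⟩) ?_
  rintro _ ⟨u, hu, rfl⟩
  rw [le_div_iff₀' hl]
  have hmem : l • u ∈ SS C (qq o e (l * s)) := by
    constructor
    · have := c.dom.mix hu.1 b.cl hl (by linarith : 0 ≤ 1 - l) (by ring)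
      convert this using 1
      unfold qq
      module
    · have := c.dom.mix hu.2 b.cl hl (by linarith : 0 ≤ 1 - l) (by ring)
      convert this using 1
      unfold qq
      module
  have := WW_ge c hmem
  rw [det2_smul] at this
  exact (le_abs_self _).trans this

/-- the doubling-type condition -/
def CondD (C : Set (Euc 2)) (o : Euc 2) (ε : ℝ) : Prop :=
  0 < ε ∧ ε < 1 ∧ ∀ e, BV C o e → ∀ s, 0 < s → s ≤ 1 → WW C o e (ε * s) ≤ (1/2) * WW C o e s

theorem CondD.iter (c : Ctx C o r0 R0) {ε : ℝ} (D : CondD C o ε) {e : Euc 2} (b : BV C o e)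
    {s s' : ℝ} (n : ℕ) (h0 : 0 < s) (hs : s ≤ ε ^ n * s') (h0' : 0 < s') (h1 : s' ≤ 1) :
    r0 / (2 * R0) * WW C o e s ≤ (1/2) ^ n * WW C o e s' := by
  obtain ⟨he, he1, D⟩ := D
  have hp : ∀ n : ℕ, ε ^ n ≤ 1 := fun n => pow_le_one₀ he.le he1.le
  have key : ∀ n : ℕ, WW C o e (ε ^ n * s') ≤ (1/2) ^ n * WW C o e s' := by
    intro n
    induction n with
    | zero => simp
    | succ k ih =>
      have := D e b (ε ^ k * s') (by positivity) (by nlinarith [hp k])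
      rw [pow_succ', mul_assoc, pow_succ', mul_assoc]
      linarith
  refine (WW_mono c b h0 hs (by nlinarith [hp n])).trans (key n)

theorem dist_lb (c : Ctx C o r0 R0) {e : Euc 2} (b : BV C o e) {s : ℝ} (h0 : 0 < s)
    (h1 : s ≤ 1) : -(1/2) * Real.log s ≤ hDist C o (qq o e s) := by
  obtain ⟨a, a', ⟨ha, ha1, x, hx, hr⟩, ⟨hb0, hb1, -⟩, he⟩ := hDist_ex c.dom c.ho (b.mem c h0 h1)
  have has : a ≤ s := by
    rcases eq_or_lt_of_le ha1 with rfl | hlt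
    · have : (1 - s) • e = 0 := by simpa [qq] using hr
      rcases smul_eq_zero.1 this with h | h
      · linarith
      · exact absurd h (b.ne0 c)
    · have h3 : 0 < 1 - a := by linarith
      have : x = o + ((1 - s) / (1 - a)) • e := by
        have h4 : (1 - a) • x = (1 - a) • (o + ((1 - s) / (1 - a)) • e) := by
          rw [smul_add, smul_smul, mul_div_cancel₀ _ h3.ne']
          have h5 : (1 - a) • x = qq o e s - a • o := by rw [hr]; module
          rw [h5]; unfold qq; module
        exact (smul_right_injective _ h3.ne') h4
      rw [this] at hx
      have := b.le1 c hx
      rw [div_le_one h3] at this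
      linarith
  have := Real.log_le_log ha has
  have := Real.log_nonpos hb0.le hb1
  rw [he]; linarith

theorem dist_ub (c : Ctx C o r0 R0) {e : Euc 2} (b : BV C o e) {s : ℝ} (h0 : 0 < s)
    (h1 : s ≤ 1) : hDist C o (qq o e s) ≤ -(1/2) * (Real.log s + Real.log (r0 / (2 * R0 + r0))) := by
  have hr := c.r0pos
  have hR := r0R0 c
  apply hDist_le c.dom c.ho (b.mem c h0 h1)
  · refine ⟨h0, h1, _, b.cl, ?_⟩
    unfold qq; module
  · have hc : 0 < r0 / (2 * R0) := by positivity
    refine ⟨by positivity, by rw [div_le_one (by positivity)]; linarith,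
      o + (r0 / (2 * R0)) • (-((1 - s) • e)), subset_closure (c.hin _ ?_), ?_⟩
    · rw [norm_smul, norm_neg, norm_smul, Real.norm_eq_abs, Real.norm_eq_abs, abs_of_pos hc,
        abs_of_nonneg (by linarith : 0 ≤ 1 - s)]
      have hn := b.norm_le c
      have hn0 := norm_nonneg e
      calc r0 / (2 * R0) * ((1 - s) * ‖e‖) ≤ r0 / (2 * R0) * (1 * R0) := by gcongr; linarith
        _ = r0 / 2 := by field_simp
        _ < r0 := by linarith
    · unfold qq
      have h2 : (1 - r0 / (2 * R0 + r0)) * (r0 / (2 * R0)) = r0 / (2 * R0 + r0) := by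
        field_simp; ring
      rw [smul_add (1 - r0 / (2 * R0 + r0)), smul_smul, h2]
      module
end

end

section
open MeasureTheory Set Filter
open scoped ENNReal NNReal

section
variable {C : Set (Euc 2)} {o : Euc 2} {r0 R0 : ℝ}

theorem half_e (c : Ctx C o r0 R0) {e : Euc 2} (b : BV C o e) {σ : ℝ} (h0 : 0 < σ)
    (h1 : σ ≤ 1/2) : (σ / 2) • e ∈ SS C (qq o e σ) := by
  constructor
  · have := b.mem c (s := σ / 2) (by linarith) (by linarith)
    convert this using 1
    unfold qq; module
  · have := b.mem c (s := σ + σ / 2) (by linarith) (by linarith)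
    convert this using 1
    unfold qq; module

/-- one-sided bound -/
theorem ue_lt (c : Ctx C o r0 R0) {e w : Euc 2} (b : BV C o e) {σ t β : ℝ}
    (hw : w ∈ SS C (qq o e σ)) (hx : o + (1 - t) • e + β • w ∈ C) : -t < |β| * σ := by
  have key : ∀ {w : Euc 2} {β : ℝ}, w ∈ SS C (qq o e σ) → 0 ≤ β → o + (1 - t) • e + β • w ∈ C →
      -t < β * σ := by
    intro w β hw hβ hx
    have hp : 0 < 1 + β := by linarith
    have := c.dom.conv hx hw.2 (a := 1 / (1 + β)) (b := β / (1 + β)) (by positivity) (by positivity)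
      (by rw [← add_div, div_self hp.ne'])
    have e1 : (1 / (1 + β)) • (o + (1 - t) • e + β • w) + (β / (1 + β)) • (qq o e σ - w)
        = o + ((1 - t + β * (1 - σ)) / (1 + β)) • e := by
      unfold qq
      have e2 : o = (1 / (1 + β)) • o + (β / (1 + β)) • o := by
        rw [← add_smul, ← add_div, div_self hp.ne', one_smul]
      nth_rewrite 3 [e2]
      rw [add_div, div_eq_mul_one_div (1 - t), div_eq_mul_one_div (β * (1 - σ)),
        div_eq_mul_one_div β]
      module
    rw [e1] at this
    have := b.lt1 c this
    rw [div_lt_one hp] at this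
    linarith
  rcases abs_cases β with ⟨h1, h2⟩ | ⟨h1, h2⟩
  · rw [h1]; exact key hw h2 hx
  · rw [h1]
    apply key (SS.neg hw) (by linarith)
    convert hx using 2
    module

theorem lemM (c : Ctx C o r0 R0) {e ex ez : Euc 2} (b : BV C o e)
    {σ sx sz sm : ℝ} {x z : Euc 2} (hx : x ∈ C) (hz : z ∈ C) (ex1 : x = qq o ex sx)
    (ez1 : z = qq o ez sz) (em : (1/2:ℝ) • x + (1/2:ℝ) • z = qq o e sm)
    (hσ : 0 < σ) (hσ1 : σ ≤ 1/2) (hsx : 0 < sx) (hsz : 0 < sz) (hsm : 0 < sm)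
    (hsx' : sx ≤ σ / 100) (hsz' : sz ≤ σ / 100) (hsm' : sm ≤ σ / 100)
    (hW : WW C o e sm ≤ (1/200) * WW C o e σ) :
    hDist C (qq o e σ) (qq o ex σ) ≤ Real.log 2 ∧ hDist C (qq o e σ) (qq o ez σ) ≤ Real.log 2 := by
  have hWp := WW_pos c b hσ (by linarith)
  obtain ⟨w, hw, hdw⟩ := WW_ex c b hσ (by linarith) (a := (1/2) * WW C o e σ) (by linarith)
  have hdw0 : 0 < det2 e w := by linarith
  set u : Euc 2 := (1/2:ℝ) • x - (1/2:ℝ) • z with hu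
  have exu : x = qq o e sm + u := by rw [← em, hu]; module
  have ezu : z = qq o e sm + (-1:ℝ) • u := by rw [← em, hu]; module
  have huS : u ∈ SS C (qq o e sm) := ⟨by rwa [← exu], by
    rwa [show qq o e sm - u = z by rw [ezu]; module]⟩
  have hdu := WW_ge c huS
  obtain ⟨a, β, hβ, hdec⟩ : ∃ a β : ℝ, |β| ≤ 1/100 ∧ u = a • e + β • w := by
    refine ⟨_, _, ?_, det2_decomp hdw0.ne' u⟩
    rw [abs_div, abs_of_pos hdw0, div_le_iff₀ hdw0]
    linarith
  have ha1 : a - sm < |β| * σ := by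
    have := ue_lt c b hw (t := sm - a) (β := β) (by
      convert hx using 1
      rw [exu, hdec]; unfold qq; module)
    linarith
  have ha2 : -a - sm < |β| * σ := by
    have := ue_lt c b hw (t := sm + a) (β := -β) (by
      convert hz using 1
      rw [ezu, hdec]; unfold qq; module)
    rw [abs_neg] at this
    linarith
  have hβσ : |β| * σ ≤ σ / 100 := by nlinarith
  have fin : ∀ (f y : Euc 2) (t θ : ℝ), |θ| = 1 → y = qq o f t → y = qq o e sm + θ • u → 0 < t →
      t ≤ σ / 100 → hDist C (qq o e σ) (qq o f σ) ≤ Real.log 2 := by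
    intro f y t θ hθ h1 h2 h3 h4
    have ht : 0 < 1 - t := by linarith
    have hk0 : 0 ≤ (1 - σ) / (1 - t) := div_nonneg (by linarith) ht.le
    have hk1 : (1 - σ) / (1 - t) ≤ 1 := by rw [div_le_one ht]; linarith
    set k := (1 - σ) / (1 - t) with hk
    have hkt : k * (1 - t) = 1 - σ := by rw [hk]; field_simp
    have e1 : qq o f σ = o + k • (y - o) := by
      rw [h1]; unfold qq; rw [← hkt]; module
    have e2 : qq o f σ - qq o e σ = (k * (t - sm + θ * a)) • e + (k * (θ * β)) • w := by
      rw [e1, h2, hdec]; unfold qq; rw [← hkt]; module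
    apply (hDist_half c.dom (b.mem c hσ (by linarith)) _).2
    have := SS_comb c.dom (b.mem c hσ (by linarith)) (half_e c b hσ hσ1) hw
      (a := 4 * (k * (t - sm + θ * a)) / σ) (b := 2 * (k * (θ * β))) ?_
    · convert this using 1
      rw [e2, smul_smul, show 4 * (k * (t - sm + θ * a)) / σ * (σ / 2) = 2 * (k * (t - sm + θ * a)) by
        field_simp; ring]
      module
    · have hA : |k * (t - sm + θ * a)| ≤ σ / 20 := by
        rw [abs_mul, abs_of_nonneg hk0]
        have : |t - sm + θ * a| ≤ σ / 20 := by
          have h5 : |θ * a| ≤ σ / 50 := by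
            rw [abs_mul, hθ, one_mul, abs_le]
            constructor <;> linarith
          have := abs_le.1 h5
          rw [abs_le]; constructor <;> linarith
        nlinarith [abs_nonneg (t - sm + θ * a)]
      have hB : |k * (θ * β)| ≤ 1/100 := by
        rw [abs_mul, abs_of_nonneg hk0, abs_mul, hθ, one_mul]
        nlinarith [abs_nonneg β]
      have h6 : |4 * (k * (t - sm + θ * a)) / σ| ≤ 1/5 := by
        rw [abs_div, abs_of_pos hσ, div_le_iff₀ hσ, abs_mul, abs_of_pos (by norm_num : (0:ℝ) < 4)]
        linarith
      have h7 : |2 * (k * (θ * β))| ≤ 1/50 := by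
        rw [abs_mul, abs_of_pos (by norm_num : (0:ℝ) < 2)]
        linarith
      linarith
  exact ⟨fin ex x sx 1 (by simp) ex1 (by rw [exu]; module) hsx hsx',
    fin ez z sz (-1) (by simp) ez1 ezu hsz hsz'⟩

theorem base_change {δ xy xz xt yz yt zt : ℝ}
    (h1 : xy ≥ min xz yz - δ) (h2 : xy ≥ min xt yt - δ) (h3 : zt ≥ min xz xt - δ)
    (h4 : zt ≥ min yz yt - δ) : xy + zt ≥ min (xz + yt) (yz + xt) - 2 * δ := by
  rcases min_cases xz yz with ⟨e1, f1⟩ | ⟨e1, f1⟩ <;>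
  rcases min_cases xt yt with ⟨e2, f2⟩ | ⟨e2, f2⟩ <;>
  rcases min_cases xz xt with ⟨e3, f3⟩ | ⟨e3, f3⟩ <;>
  rcases min_cases yz yt with ⟨e4, f4⟩ | ⟨e4, f4⟩ <;>
  rcases min_cases (xz + yt) (yz + xt) with ⟨e5, f5⟩ | ⟨e5, f5⟩ <;>
  rw [e5] <;> linarith

theorem hyp_of_base (h : HDom C) (ho : o ∈ C) {δ : ℝ}
    (H : ∀ x ∈ C, ∀ y ∈ C, ∀ z ∈ C, gromovProd (hDist C) x y o ≥
      min (gromovProd (hDist C) x z o) (gromovProd (hDist C) y z o) - δ) :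
    IsDeltaHyp C (2 * δ) := by
  intro x hx y hy z hz t ht
  have h1 := H x hx y hy z hz
  have h2 := H x hx y hy t ht
  have h3 := H z hz t ht x hx
  have h4 := H z hz t ht y hy
  have gc : ∀ {p q : Euc 2}, p ∈ C → q ∈ C →
      gromovProd (hDist C) p q o = gromovProd (hDist C) q p o := by
    intro p q hp hq
    unfold gromovProd
    rw [hDist_comm h hp hq]; ring
  rw [gc hz hx, gc ht hx] at h3
  rw [gc hz hy, gc ht hy] at h4
  have := base_change h1 h2 h3 h4
  rw [ge_iff_le, sub_le_iff_le_add, min_le_iff] at this ⊢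
  unfold gromovProd at *
  rcases this with h5 | h5
  · left; linarith
  · right; linarith

theorem hyp_of_D (c : Ctx C o r0 R0) {ε : ℝ} (D : CondD C o ε) :
    ∃ δ : ℝ, 0 ≤ δ ∧ IsDeltaHyp C δ := by
  have h := c.dom
  have hr := c.r0pos
  have hR := r0R0 c
  have he := D.1
  have he1 := D.2.1
  have hc0 : 0 < r0 / (2 * R0) := by positivity
  obtain ⟨n, hn⟩ := exists_pow_lt_of_lt_one (show 0 < r0 / (2 * R0) / 200 by positivity)
    (show (1/2 : ℝ) < 1 by norm_num)
  obtain ⟨n', hn'⟩ := exists_pow_lt_of_lt_one (show (0:ℝ) < 1 / 100 by positivity) he1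
  set κ := ε ^ (n + n') with hκ
  have hκ0 : 0 < κ := by positivity
  have hκ1 : κ ≤ 1 / 100 := by
    rw [hκ, pow_add]
    have : ε ^ n ≤ 1 := pow_le_one₀ he.le he1.le
    nlinarith [pow_pos he n']
  have hκW : ∀ e, BV C o e → ∀ s σ : ℝ, 0 < s → 0 < σ → σ ≤ 1 → s ≤ κ * σ →
      WW C o e s ≤ (1/200) * WW C o e σ := by
    intro e b s σ h0 hσ hσ1 hs
    have := D.iter c b n h0 (s' := σ) (hs.trans (by
      rw [hκ, pow_add]
      have : ε ^ n' ≤ 1 := pow_le_one₀ he.le he1.le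
      have h3 : 0 ≤ ε ^ n * σ := by positivity
      nlinarith)) hσ hσ1
    have hWp := WW_pos c b hσ hσ1
    have h5 : r0 / (2 * R0) * WW C o e s ≤ r0 / (2 * R0) * (1 / 200 * WW C o e σ) := by
      refine this.trans ?_
      have : (1/2)^n * WW C o e σ ≤ r0 / (2 * R0) / 200 * WW C o e σ := by gcongr
      linarith
    exact le_of_mul_le_mul_left h5 hc0
  set A := (r0 / (2 * R0 + r0))⁻¹ with hA
  have hA1 : 1 ≤ A := by
    rw [hA, one_le_inv₀ (by positivity), div_le_one (by positivity)]; linarith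
  have hA0 : 0 < A := by linarith
  have hAlog : Real.log (r0 / (2 * R0 + r0)) = - Real.log A := by rw [hA, Real.log_inv]; ring
  have l2 : 0 < Real.log 2 := Real.log_pos (by norm_num)
  -- size bound
  have hsz : ∀ e, BV C o e → ∀ s, 0 < s → s ≤ 1 → ∀ G, G ≤ hDist C o (qq o e s) →
      s ≤ A * Real.exp (-2 * G) := by
    intro e b s h0 h1 G hG
    have := dist_ub c b h0 h1
    rw [hAlog] at this
    rw [← Real.log_le_log_iff h0 (by positivity), Real.log_mul hA0.ne' (Real.exp_ne_zero _),
      Real.log_exp]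
    linarith
  have pair : ∀ x ∈ C, ∀ z ∈ C, ∀ ex ez sx sz σ G, BV C o ex → BV C o ez → x = qq o ex sx →
      z = qq o ez sz → 0 < sx → 0 < sz → sx ≤ 1 → sz ≤ 1 → 0 < σ → σ ≤ 1/2 →
      σ = A / κ * Real.exp (-2 * G) → G ≤ gromovProd (hDist C) x z o →
      hDist C (qq o ex σ) (qq o ez σ) ≤ 2 * Real.log 2 ∧ sx ≤ σ ∧ sz ≤ σ := by
    intro x hx z hz ex ez sx sz σ G bx bz ex1 ez1 hsx hsz0 hsx1 hsz1 hσ hσ1 hσe hG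
    have hm : (1/2:ℝ) • x + (1/2:ℝ) • z ∈ C := h.conv hx hz (by norm_num) (by norm_num) (by norm_num)
    obtain ⟨e, sm, b, hsm, hsm1, em⟩ := param c hm
    have hκσ : κ * σ = A * Real.exp (-2 * G) := by rw [hσe]; field_simp
    have ho := c.ho
    have c1 := hDist_comm h hx ho
    have c2 := hDist_comm h hz ho
    have c3 := hDist_comm h hm ho
    have c4 := hDist_comm h hm hz
    unfold gromovProd at hG
    have g1 : sm ≤ κ * σ := by
      rw [hκσ]
      apply hsz e b sm hsm hsm1
      rw [← em]
      have t1 := hDist_add h hx hz (t := 1/2) (by norm_num) (by norm_num)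
      rw [show (1 - 1/2 : ℝ) = 1/2 by norm_num] at t1
      have t2 := hDist_tri h hx hm ho
      have t3 := hDist_tri h hz hm ho
      linarith
    have g2 : sx ≤ κ * σ := by
      rw [hκσ]
      apply hsz ex bx sx hsx hsx1
      rw [← ex1]
      have t3 := hDist_tri h hz hx ho
      have := hDist_comm h hx hz
      linarith
    have g3 : sz ≤ κ * σ := by
      rw [hκσ]
      apply hsz ez bz sz hsz0 hsz1
      rw [← ez1]
      have t3 := hDist_tri h hx hz ho
      linarith
    have hk : κ * σ ≤ σ / 100 := by nlinarith
    have := lemM c b hx hz ex1 ez1 em hσ hσ1 hsx hsz0 hsm (g2.trans hk) (g3.trans hk)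
      (g1.trans hk) (hκW e b sm σ hsm hσ (by linarith) g1)
    have q0 := b.mem c hσ (by linarith)
    have q1 := bx.mem c hσ (by linarith)
    have q2 := bz.mem c hσ (by linarith)
    have t := hDist_tri h q1 q0 q2
    rw [hDist_comm h q1 q0] at t
    exact ⟨by linarith, by linarith, by linarith⟩
  have hAκ : 0 ≤ Real.log (A / κ) := Real.log_nonneg (by
    rw [le_div_iff₀ hκ0]; linarith)
  refine ⟨2 * ((1/2) * Real.log (A / κ) + 2 * Real.log 2), by positivity, hyp_of_base h c.ho ?_⟩
  intro x hx y hy z hz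
  obtain ⟨ex, sx, bx, hsx, hsx1, ex1⟩ := param c hx
  obtain ⟨ey, sy, by', hsy, hsy1, ey1⟩ := param c hy
  obtain ⟨ez, sz, bz, hsz0, hsz1, ez1⟩ := param c hz
  set G := min (gromovProd (hDist C) x z o) (gromovProd (hDist C) y z o) with hGdef
  set σ := A / κ * Real.exp (-2 * G) with hσ
  have hσ0 : 0 < σ := by positivity
  have hlogσ : Real.log σ = Real.log (A / κ) - 2 * G := by
    rw [hσ, Real.log_mul (by positivity) (Real.exp_ne_zero _), Real.log_exp]; ring
  have ho := c.ho
  have c1 := hDist_comm h hx ho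
  have c2 := hDist_comm h hy ho
  rcases le_or_gt σ (1/2) with hs | hs
  · obtain ⟨p1, p2, p3⟩ := pair x hx z hz ex ez sx sz σ G bx bz ex1 ez1 hsx hsz0 hsx1 hsz1 hσ0 hs hσ
      (min_le_left _ _)
    obtain ⟨p1', p2', p3'⟩ := pair y hy z hz ey ez sy sz σ G by' bz ey1 ez1 hsy hsz0 hsy1 hsz1 hσ0 hs hσ
      (min_le_right _ _)
    have q1 := bx.mem c hσ0 (by linarith)
    have q2 := by'.mem c hσ0 (by linarith)
    have q3 := bz.mem c hσ0 (by linarith)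
    have rad : ∀ e, BV C o e → ∀ s, 0 < s → s ≤ σ → hDist C o (qq o e s) ≥
        -(1/2) * Real.log σ + hDist C (qq o e σ) (qq o e s) := by
      intro e b s h0 h1
      have hs1 : 0 < 1 - s := by linarith
      have t := hDist_add h ho (b.mem c h0 (by linarith)) (t := (1 - σ) / (1 - s))
        (div_nonneg (by linarith) hs1.le) (by rw [div_le_one hs1]; linarith)
      have e1 : (1 - (1 - σ) / (1 - s)) • o + ((1 - σ) / (1 - s)) • qq o e s = qq o e σ := by
        unfold qq
        rw [smul_add, smul_smul, div_mul_cancel₀ _ hs1.ne']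
        module
      rw [e1] at t
      have := dist_lb c b hσ0 (by linarith : σ ≤ 1)
      linarith
    have r1 := rad ex bx sx hsx p2
    have r2 := rad ey by' sy hsy p2'
    rw [← ex1] at r1
    rw [← ey1] at r2
    have t1 := hDist_tri h hx q1 hy
    have t2 := hDist_tri h q1 q2 hy
    have t3 := hDist_tri h q1 q3 q2
    rw [hDist_comm h q3 q2] at t3
    rw [hDist_comm h hx q1] at t1
    unfold gromovProd
    rw [hlogσ] at r1 r2
    linarith
  · have h1 : gromovProd (hDist C) x y o ≥ 0 := by
      unfold gromovProd
      have := hDist_tri h hx ho hy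
      linarith
    have := Real.log_lt_log (by norm_num) hs
    rw [hlogσ, one_div, Real.log_inv] at this
    linarith
end

end

section
open MeasureTheory Set Filter
open scoped ENNReal NNReal

section
variable {C : Set (Euc 2)} {c v1 v2 : Euc 2} {η : ℝ}

/-- affine coordinates -/
noncomputable def PP (c v1 v2 : Euc 2) (h Y : ℝ) : Euc 2 := c + h • v1 + Y • v2

theorem PP_swap (c v1 v2 : Euc 2) (h Y : ℝ) : PP c v1 v2 h Y = PP c v2 v1 Y h := by
  unfold PP; module

/-- a box in the domain -/
def Box (C : Set (Euc 2)) (η : ℝ) (c v1 v2 : Euc 2) : Prop :=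
  ∀ h Y, η ≤ h → h ≤ 1 → η ≤ Y → Y ≤ 1 → PP c v1 v2 h Y ∈ C

theorem Box.swap (b : Box C η c v1 v2) : Box C η c v2 v1 := by
  intro h Y h1 h2 h3 h4
  rw [PP_swap]; exact b Y h h3 h4 h1 h2

theorem box_RR (h : HDom C) (hη : 0 < η) (b : Box C η c v1 v2) {h1 h2 Y : ℝ} (k1 : 2 * η ≤ h1)
    (k2 : h1 ≤ h2) (k3 : h2 ≤ 1/2) (k4 : η ≤ Y) (k5 : Y ≤ 1) :
    hDist C (PP c v1 v2 h1 Y) (PP c v1 v2 h2 Y) ≤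
      -(1/2) * (Real.log ((1 - h2) / (1 - h1)) + Real.log ((h1 - η) / (h2 - η))) := by
  have p1 : 0 < 1 - h1 := by linarith
  have p2 : 0 < h2 - η := by linarith
  apply hDist_le h (b _ _ (by linarith) (by linarith) k4 k5) (b _ _ (by linarith) (by linarith) k4 k5)
  · refine ⟨div_pos (by linarith) p1, by rw [div_le_one p1]; linarith, PP c v1 v2 1 Y,
      subset_closure (b _ _ (by linarith) (by linarith) k4 k5), ?_⟩
    have : h2 = (1 - h2) / (1 - h1) * h1 + (1 - (1 - h2) / (1 - h1)) * 1 := by field_simp; ring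
    unfold PP
    nth_rewrite 1 [this]
    module
  · refine ⟨div_pos (by linarith) p2, by rw [div_le_one p2]; linarith, PP c v1 v2 η Y,
      subset_closure (b _ _ (by linarith) (by linarith) k4 k5), ?_⟩
    have : h1 = (h1 - η) / (h2 - η) * h2 + (1 - (h1 - η) / (h2 - η)) * η := by field_simp; ring
    unfold PP
    nth_rewrite 1 [this]
    module

theorem box_d1 (h : HDom C) (hη : 0 < η) (b : Box C η c v1 v2) {h1 h2 Y : ℝ} (k1 : 2 * η ≤ h1)
    (k2 : h1 ≤ h2) (k3 : h2 ≤ 1/2) (k4 : η ≤ Y) (k5 : Y ≤ 1) :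
    hDist C (PP c v1 v2 h1 Y) (PP c v1 v2 h2 Y) ≤ 2 * (Real.log h2 - Real.log h1) := by
  have := box_RR h hη b k1 k2 k3 k4 k5
  have p1 : 0 < 1 - h1 := by linarith
  have p2 : 0 < h2 - η := by linarith
  have q1 : 0 < h1 := by linarith
  have q2 : 0 < h2 := by linarith
  have e1 : Real.log ((h1 / h2) ^ 2) = 2 * (Real.log h1 - Real.log h2) := by
    rw [Real.log_pow, Real.log_div q1.ne' q2.ne']; norm_num
  have l1 : Real.log ((h1 / h2) ^ 2) ≤ Real.log ((1 - h2) / (1 - h1)) := by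
    apply Real.log_le_log (by positivity)
    rw [div_pow, div_le_div_iff₀ (by positivity) p1]
    nlinarith [mul_nonneg (sub_nonneg.2 k2) (by nlinarith : 0 ≤ h1 + h2 - h1 ^ 2 - h1 * h2 - h2 ^ 2)]
  have l2 : Real.log ((h1 / h2) ^ 2) ≤ Real.log ((h1 - η) / (h2 - η)) := by
    apply Real.log_le_log (by positivity)
    rw [div_pow, div_le_div_iff₀ (by positivity) p2]
    nlinarith [mul_nonneg (sub_nonneg.2 k2) (by nlinarith : 0 ≤ h1 * h2 - η * (h1 + h2))]
  linarith

theorem box_d2 (h : HDom C) (hη : 0 < η) (b : Box C η c v1 v2) {h1 h2 Y : ℝ} (k1 : 2 * η ≤ h1)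
    (k2 : h1 ≤ h2) (k3 : h2 ≤ 1/2) (k4 : η ≤ Y) (k5 : Y ≤ 1) :
    hDist C (PP c v1 v2 h1 Y) (PP c v1 v2 h2 Y) ≤
      (1/2) * (Real.log h2 - Real.log h1 + 2 * Real.log 2) := by
  have := box_RR h hη b k1 k2 k3 k4 k5
  have p1 : 0 < 1 - h1 := by linarith
  have p2 : 0 < h2 - η := by linarith
  have q1 : 0 < h1 := by linarith
  have q2 : 0 < h2 := by linarith
  have l1 : - Real.log 2 ≤ Real.log ((1 - h2) / (1 - h1)) := by
    rw [← Real.log_inv]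
    apply Real.log_le_log (by positivity)
    rw [le_div_iff₀ p1]
    linarith
  have l2 : Real.log h1 - Real.log h2 - Real.log 2 ≤ Real.log ((h1 - η) / (h2 - η)) := by
    rw [← Real.log_div q1.ne' q2.ne', ← Real.log_div (by positivity) (by positivity)]
    apply Real.log_le_log (by positivity)
    rw [div_div, div_le_div_iff₀ (by positivity) p2]
    nlinarith
  linarith

theorem PP_coord1 (hd : det2 v1 v2 ≠ 0) (h Y : ℝ) :
    det2 (PP c v1 v2 h Y - c) v2 / det2 v1 v2 = h := by
  rw [div_eq_iff hd]; simp [PP, det2]; ring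
theorem PP_coord2 (hd : det2 v1 v2 ≠ 0) (h Y : ℝ) :
    det2 v1 (PP c v1 v2 h Y - c) / det2 v1 v2 = Y := by
  rw [div_eq_iff hd]; simp [PP, det2]; ring
theorem PP_inv (hd : det2 v1 v2 ≠ 0) (x : Euc 2) :
    PP c v1 v2 (det2 (x - c) v2 / det2 v1 v2) (det2 v1 (x - c) / det2 v1 v2) = x := by
  unfold PP
  rw [add_assoc, ← det2_decomp hd (x - c)]; module

/-- coordinates as a homeomorphism -/
noncomputable def PPh (c v1 v2 : Euc 2) (hd : det2 v1 v2 ≠ 0) : ℝ × ℝ ≃ₜ Euc 2 where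
  toFun z := PP c v1 v2 z.1 z.2
  invFun x := (det2 (x - c) v2 / det2 v1 v2, det2 v1 (x - c) / det2 v1 v2)
  left_inv z := by
    ext
    · exact PP_coord1 hd _ _
    · exact PP_coord2 hd _ _
  right_inv x := PP_inv hd x
  continuous_toFun := by unfold PP; fun_prop
  continuous_invFun := by unfold det2; fun_prop

/-- positivity of coordinates -/
def PosC (C : Set (Euc 2)) (c v1 v2 : Euc 2) : Prop :=
  ∀ h Y, PP c v1 v2 h Y ∈ C → 0 < h ∧ 0 < Y

theorem PosC.swap (b : PosC C c v1 v2) : PosC C c v2 v1 := by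
  intro h Y hh
  rw [PP_swap] at hh
  exact (b _ _ hh).symm

theorem PosC.cl (hd : det2 v1 v2 ≠ 0) (b : PosC C c v1 v2) {h Y : ℝ}
    (hh : PP c v1 v2 h Y ∈ closure C) : 0 ≤ h := by
  have hcl : IsClosed {x : Euc 2 | 0 ≤ det2 (x - c) v2 / det2 v1 v2} :=
    isClosed_le continuous_const (by unfold det2; fun_prop)
  have hs : C ⊆ {x : Euc 2 | 0 ≤ det2 (x - c) v2 / det2 v1 v2} := by
    intro x hx
    rw [← PP_inv (c := c) hd x] at hx
    exact (b _ _ hx).1.le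
  have := closure_minimal hs hcl hh
  change 0 ≤ det2 (PP c v1 v2 h Y - c) v2 / det2 v1 v2 at this
  rwa [PP_coord1 hd] at this

theorem PosC.RR (hd : det2 v1 v2 ≠ 0) (b : PosC C c v1 v2) {h Y h' Y' a : ℝ}
    (hr : RR C (PP c v1 v2 h Y) (PP c v1 v2 h' Y') a) : a * h ≤ h' := by
  obtain ⟨ha, ha1, x, hx, he⟩ := hr
  rw [← PP_inv (c := c) hd x] at hx he
  have := b.cl hd hx
  have h2 : h' = a * h + (1 - a) * (det2 (x - c) v2 / det2 v1 v2) := by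
    have e1 := PP_coord1 (c := c) hd h' Y'
    rw [he] at e1
    rw [← e1]
    have := PP_coord1 (c := c) hd (a * h + (1 - a) * (det2 (x - c) v2 / det2 v1 v2))
      (a * Y + (1 - a) * (det2 v1 (x - c) / det2 v1 v2))
    rw [← this]
    congr 2
    unfold PP; module
  nlinarith

theorem pos_lb1 (h : HDom C) (hd : det2 v1 v2 ≠ 0) (b : PosC C c v1 v2) {s Y s' Y' : ℝ}
    (m1 : PP c v1 v2 s Y ∈ C) (m2 : PP c v1 v2 s' Y' ∈ C) :
    (1/2) * (Real.log s - Real.log s') ≤ hDist C (PP c v1 v2 s Y) (PP c v1 v2 s' Y') := by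
  obtain ⟨a, a', h1, h2, he⟩ := hDist_ex h m1 m2
  have k := b.RR hd h1
  have p1 := (b _ _ m1).1
  have p2 := (b _ _ m2).1
  have := Real.log_le_log (mul_pos h1.1 p1) k
  rw [Real.log_mul h1.1.ne' p1.ne'] at this
  have := Real.log_nonpos h2.1.le h2.2.1
  linarith

theorem pos_lb2 (h : HDom C) (hd : det2 v1 v2 ≠ 0) (b : PosC C c v1 v2) {s Y s' Y' : ℝ}
    (m1 : PP c v1 v2 s Y ∈ C) (m2 : PP c v1 v2 s' Y' ∈ C) :
    (1/2) * (Real.log s - Real.log s' + (Real.log Y' - Real.log Y)) ≤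
      hDist C (PP c v1 v2 s Y) (PP c v1 v2 s' Y') := by
  obtain ⟨a, a', h1, h2, he⟩ := hDist_ex h m1 m2
  have k := b.RR hd h1
  have p1 := (b _ _ m1).1
  have := Real.log_le_log (mul_pos h1.1 p1) k
  rw [Real.log_mul h1.1.ne' p1.ne'] at this
  have hs := h2
  rw [PP_swap, PP_swap c v1 v2 s Y] at hs
  have k' := b.swap.RR (by rw [det2_swap]; simpa using hd) hs
  have p3 := (b _ _ m2).2
  have := Real.log_le_log (mul_pos h2.1 p3) k'
  rw [Real.log_mul h2.1.ne' p3.ne'] at this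
  linarith

/-- corner of quality `η` -/
def Corner (C : Set (Euc 2)) (η : ℝ) : Prop :=
  ∃ c v1 v2, det2 v1 v2 ≠ 0 ∧ Box C η c v1 v2 ∧ PosC C c v1 v2

theorem not_hyp (h : HDom C) (H : ∀ η, 0 < η → Corner C η) :
    ¬ ∃ δ : ℝ, 0 ≤ δ ∧ IsDeltaHyp C δ := by
  rintro ⟨δ, hδ, hh⟩
  have l2 : 0 < Real.log 2 := Real.log_pos (by norm_num)
  set N := 4 * δ + 8 * Real.log 2 with hN
  have hl : Real.log (1/2) = - Real.log 2 := by rw [one_div, Real.log_inv]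
  set β := Real.exp (-N) with hβ
  have hβ0 : 0 < β := Real.exp_pos _
  have hlβ : Real.log β = -N := Real.log_exp _
  have hβ1 : β ≤ 1/2 := by
    rw [← Real.log_le_log_iff hβ0 (by norm_num), hl, hlβ]; linarith
  obtain ⟨c, v1, v2, hd, b, p⟩ := H (β / 2) (by positivity)
  have hη : 0 < β / 2 := by positivity
  have mx := b (1/2) (1/2) (by linarith) (by norm_num) (by linarith) (by norm_num)
  have ma := b (1/2) β (by linarith) (by norm_num) (by linarith) (by linarith)
  have mb := b β (1/2) (by linarith) (by linarith) (by linarith) (by linarith)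
  have mc := b β β (by linarith) (by linarith) (by linarith) (by linarith)
  have d1 := box_d2 h hη b (h1 := β) (h2 := 1/2) (Y := 1/2) (by linarith) hβ1 le_rfl (by linarith)
    (by linarith)
  have d2 := box_d2 h hη b (h1 := β) (h2 := 1/2) (Y := β) (by linarith) hβ1 le_rfl (by linarith)
    (by linarith)
  have d3 := box_d2 h hη b.swap (h1 := β) (h2 := 1/2) (Y := 1/2) (by linarith) hβ1 le_rfl (by linarith)
    (by linarith)
  have d4 := box_d2 h hη b.swap (h1 := β) (h2 := 1/2) (Y := β) (by linarith) hβ1 le_rfl (by linarith)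
    (by linarith)
  have g1 := pos_lb2 h hd p ma mb
  have g2 := pos_lb1 h hd p mx mc
  have g3 := pos_lb1 h hd p mx mb
  have g4 := pos_lb1 h (by rw [det2_swap]; simpa using hd) p.swap (s := 1/2) (Y := 1/2) (s' := β)
    (Y' := 1/2) (by rwa [PP_swap]) (by rwa [PP_swap])
  rw [← PP_swap c v1 v2, ← PP_swap c v1 v2] at d3 d4 g4
  have := hh _ ma _ mb _ mc _ mx
  rw [ge_iff_le, sub_le_iff_le_add, min_le_iff] at this
  unfold gromovProd at this
  rw [hDist_comm h mc mx, hDist_comm h ma mc, hDist_comm h mb mc] at this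
  rw [hDist_comm h mx mb] at g3
  rw [hDist_comm h mx ma] at g4
  rw [hl, hlβ] at *
  rcases this with h5 | h5 <;> linarith
end

end

section
open MeasureTheory Set Filter
open scoped ENNReal NNReal

theorem ediamD_le {α : Type*} {d : α → α → ℝ} {S : Set α} {x : ℝ≥0∞}
    (h : ∀ p ∈ S, ∀ q ∈ S, ENNReal.ofReal (d p q) ≤ x) : ediamD d S ≤ x :=
  iSup₂_le fun p hp => iSup₂_le fun q hq => h p hp q hq

theorem hausD_lip {α : Type*} {d : α → α → ℝ} {c : ℝ → α} {L : ℝ} (hL : 0 ≤ L)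
    (h : ∀ s ∈ Icc (0:ℝ) 1, ∀ t ∈ Icc (0:ℝ) 1, d (c s) (c t) ≤ L * |s - t|) :
    hausD 1 d (c '' Icc 0 1) ≤ ENNReal.ofReal L := by
  unfold hausD
  refine iSup₂_le fun ε hε => ?_
  obtain ⟨N, hN0, hN⟩ : ∃ N : ℕ, 0 < N ∧ ENNReal.ofReal (L / N) ≤ ε := by
    rcases eq_or_ne ε ⊤ with rfl | hε'
    · exact ⟨1, one_pos, le_top⟩
    · have he : 0 < ε.toReal := ENNReal.toReal_pos hε.ne' hε'
      obtain ⟨N, hN⟩ := exists_nat_gt (L / ε.toReal)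
      have hN0 : (0:ℝ) < N := lt_of_le_of_lt (by positivity) hN
      refine ⟨N, by exact_mod_cast hN0, ?_⟩
      rw [ENNReal.ofReal_le_iff_le_toReal hε', div_le_iff₀ hN0]
      rw [div_lt_iff₀ he] at hN
      linarith
  have hN0' : (0:ℝ) < N := by exact_mod_cast hN0
  let U : ℕ → Set α := fun i => if i < N then c '' Icc (i / N : ℝ) ((i + 1) / N) else ∅
  have hU : ∀ i, ediamD d (U i) ≤ if i < N then ENNReal.ofReal (L / N) else 0 := by
    intro i
    by_cases hi : i < N
    · simp only [U, if_pos hi]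
      apply ediamD_le
      rintro _ ⟨s, hs, rfl⟩ _ ⟨t, ht, rfl⟩
      apply ENNReal.ofReal_le_ofReal
      have hi1 : ((i:ℝ) + 1) / N ≤ 1 := by
        rw [div_le_one hN0']; exact_mod_cast hi
      have hi0 : (0:ℝ) ≤ i / N := by positivity
      refine (h s ⟨by linarith [hs.1], by linarith [hs.2]⟩ t
        ⟨by linarith [ht.1], by linarith [ht.2]⟩).trans ?_
      rw [div_eq_mul_one_div L]
      have : |s - t| ≤ 1 / N := by
        have e : ((i:ℝ) + 1) / N = i / N + 1 / N := by rw [add_div]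
        rw [abs_le]
        constructor <;> linarith [hs.1, hs.2, ht.1, ht.2]
      gcongr
    · simp only [U, if_neg hi]
      apply ediamD_le
      simp
  have hcov : c '' Icc 0 1 ⊆ ⋃ i, U i := by
    rintro _ ⟨t, ht, rfl⟩
    rw [mem_iUnion]
    rcases eq_or_lt_of_le ht.2 with h1 | h1
    · refine ⟨N - 1, ?_⟩
      have hlt : N - 1 < N := by omega
      simp only [U, if_pos hlt]
      refine ⟨t, ⟨?_, ?_⟩, rfl⟩
      · rw [h1, div_le_one hN0']; exact_mod_cast hlt.le
      · rw [h1, le_div_iff₀ hN0', one_mul, Nat.cast_sub hN0]; push_cast; linarith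
    · refine ⟨⌊t * N⌋₊, ?_⟩
      have hlt : ⌊t * N⌋₊ < N := by
        rw [Nat.floor_lt (by nlinarith [ht.1])]; nlinarith
      simp only [U, if_pos hlt]
      refine ⟨t, ⟨?_, ?_⟩, rfl⟩
      · rw [div_le_iff₀ hN0']; exact Nat.floor_le (by nlinarith [ht.1])
      · rw [le_div_iff₀ hN0']; exact (Nat.lt_floor_add_one _).le
  have hdiam : ∀ i, ediamD d (U i) ≤ ε := by
    intro i
    refine (hU i).trans ?_
    split_ifs
    · exact hN
    · exact bot_le
  refine (iInf_le _ U).trans ((iInf_le _ hcov).trans ((iInf_le _ hdiam).trans ?_))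
  · calc ∑' i, ediamD d (U i) ^ (1:ℝ) ≤ ∑' i, (if i < N then ENNReal.ofReal (L / N) else 0) := by
          refine ENNReal.tsum_le_tsum fun i => ?_
          rw [ENNReal.rpow_one]; exact hU i
      _ = ∑ i ∈ Finset.range N, (if i < N then ENNReal.ofReal (L / N) else 0) :=
          tsum_eq_sum (by intro i hi; rw [if_neg]; simpa using hi)
      _ = ∑ i ∈ Finset.range N, ENNReal.ofReal (L / N) :=
          Finset.sum_congr rfl (by intro i hi; rw [if_pos]; simpa using hi)
      _ = ENNReal.ofReal L := by
          rw [Finset.sum_const, Finset.card_range, nsmul_eq_mul, ← ENNReal.ofReal_natCast,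
            ← ENNReal.ofReal_mul (by positivity)]
          congr 1; field_simp
      _ ≤ _ := le_rfl

/-- loop coordinates -/
noncomputable def lpx (t : ℝ) : ℝ := max 0 (min 1 (min (4 * t) (3 - 4 * t)))
/-- loop coordinates -/
noncomputable def lpy (t : ℝ) : ℝ := max 0 (min 1 (min (4 * t - 1) (4 - 4 * t)))

theorem lp_lip_aux {A B A' B' k : ℝ} (h1 : |A - A'| ≤ k) (h2 : |B - B'| ≤ k) :
    |max 0 (min 1 (min A B)) - max 0 (min 1 (min A' B'))| ≤ k := by
  have hk : 0 ≤ k := (abs_nonneg _).trans h1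
  refine (abs_max_sub_max_le_max _ _ _ _).trans (max_le (by simpa using hk) ?_)
  refine (abs_min_sub_min_le_max _ _ _ _).trans (max_le (by simpa using hk) ?_)
  exact (abs_min_sub_min_le_max _ _ _ _).trans (max_le h1 h2)

theorem lpx_lip (s t : ℝ) : |lpx s - lpx t| ≤ 4 * |s - t| := by
  apply lp_lip_aux
  · rw [← mul_sub, abs_mul]; norm_num
  · rw [show 3 - 4 * s - (3 - 4 * t) = (-4) * (s - t) by ring, abs_mul]; norm_num
theorem lpy_lip (s t : ℝ) : |lpy s - lpy t| ≤ 4 * |s - t| := by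
  apply lp_lip_aux
  · rw [show 4 * s - 1 - (4 * t - 1) = 4 * (s - t) by ring, abs_mul]; norm_num
  · rw [show 4 - 4 * s - (4 - 4 * t) = (-4) * (s - t) by ring, abs_mul]; norm_num

theorem lpx_mem (t : ℝ) : 0 ≤ lpx t ∧ lpx t ≤ 1 :=
  ⟨le_max_left _ _, max_le (by norm_num) (min_le_left _ _)⟩
theorem lpy_mem (t : ℝ) : 0 ≤ lpy t ∧ lpy t ≤ 1 :=
  ⟨le_max_left _ _, max_le (by norm_num) (min_le_left _ _)⟩

theorem lp_bd {t : ℝ} (h0 : 0 ≤ t) (h1 : t ≤ 1) : lpx t = 0 ∨ lpx t = 1 ∨ lpy t = 0 ∨ lpy t = 1 := by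
  unfold lpx lpy
  rcases le_total t (1/4) with h | h
  · right; right; left
    rw [max_eq_left]; exact (min_le_right _ _).trans ((min_le_left _ _).trans (by linarith))
  rcases le_total t (1/2) with h' | h'
  · right; left
    rw [min_eq_left (le_min (by linarith) (by linarith))]; norm_num
  rcases le_total t (3/4) with h'' | h''
  · right; right; right
    rw [min_eq_left (le_min (by linarith) (by linarith))]; norm_num
  · left
    rw [max_eq_left]; exact (min_le_right _ _).trans ((min_le_right _ _).trans (by linarith))

theorem lp_surj {x y : ℝ} (hx0 : 0 ≤ x) (hx1 : x ≤ 1) (hy0 : 0 ≤ y) (hy1 : y ≤ 1)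
    (h : x = 0 ∨ x = 1 ∨ y = 0 ∨ y = 1) : ∃ t ∈ Icc (0:ℝ) 1, lpx t = x ∧ lpy t = y := by
  unfold lpx lpy
  rcases h with rfl | rfl | rfl | rfl
  · refine ⟨(4 - y) / 4, ⟨by linarith, by linarith⟩, ?_, ?_⟩
    · rw [max_eq_left]; exact (min_le_right _ _).trans ((min_le_right _ _).trans (by linarith))
    · rw [min_eq_right (by linarith : 4 - 4 * ((4 - y) / 4) ≤ 4 * ((4 - y) / 4) - 1),
        min_eq_right (by linarith), max_eq_right (by linarith)]; ring
  · refine ⟨(1 + y) / 4, ⟨by linarith, by linarith⟩, ?_, ?_⟩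
    · rw [min_eq_left (le_min (by linarith) (by linarith))]; norm_num
    · rw [min_eq_left (by linarith : 4 * ((1 + y) / 4) - 1 ≤ 4 - 4 * ((1 + y) / 4)),
        min_eq_right (by linarith), max_eq_right (by linarith)]; ring
  · refine ⟨x / 4, ⟨by linarith, by linarith⟩, ?_, ?_⟩
    · rw [min_eq_left (by linarith : 4 * (x / 4) ≤ 3 - 4 * (x / 4)),
        min_eq_right (by linarith), max_eq_right (by linarith)]; ring
    · rw [max_eq_left]; exact (min_le_right _ _).trans ((min_le_left _ _).trans (by linarith))
  · refine ⟨(3 - x) / 4, ⟨by linarith, by linarith⟩, ?_, ?_⟩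
    · rw [min_eq_right (by linarith : 3 - 4 * ((3 - x) / 4) ≤ 4 * ((3 - x) / 4)),
        min_eq_right (by linarith), max_eq_right (by linarith)]; ring
    · rw [min_eq_left (le_min (by linarith) (by linarith))]; norm_num

section
variable {C : Set (Euc 2)} {c v1 v2 : Euc 2} {η : ℝ}

theorem box_d3 (h : HDom C) (hη : 0 < η) (b : Box C η c v1 v2) {h1 h2 Y : ℝ} (k1 : 2 * η ≤ h1)
    (k1' : 2 * η ≤ h2) (k3 : h1 ≤ 1/2) (k3' : h2 ≤ 1/2) (k4 : η ≤ Y) (k5 : Y ≤ 1) :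
    hDist C (PP c v1 v2 h1 Y) (PP c v1 v2 h2 Y) ≤ 2 * |Real.log h1 - Real.log h2| := by
  rcases le_total h1 h2 with hh | hh
  · have := box_d1 h hη b k1 hh k3' k4 k5
    rw [abs_sub_comm]
    exact this.trans (by gcongr; exact le_abs_self _)
  · have := box_d1 h hη b k1' hh k3 k4 k5
    rw [hDist_comm h (b _ _ (by linarith) (by linarith) k4 k5) (b _ _ (by linarith) (by linarith) k4 k5)]
    exact this.trans (by gcongr; exact le_abs_self _)

/-- the test rectangle -/
def rectU (c v1 v2 : Euc 2) (η : ℝ) : Set (Euc 2) :=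
  (fun z : ℝ × ℝ => PP c v1 v2 z.1 z.2) '' (Ioo (2 * η) (1/2) ×ˢ Ioo (2 * η) (1/2))

theorem rectU_props (h : HDom C) (hd : det2 v1 v2 ≠ 0) (hη : 0 < η) (hη1 : η < 1/4)
    (b : Box C η c v1 v2) :
    IsOpen (rectU c v1 v2 η) ∧ (rectU c v1 v2 η).Nonempty ∧ closure (rectU c v1 v2 η) ⊆ C ∧
    RectCurveBoundary C (rectU c v1 v2 η) ∧ hausD 1 (hDist C) (frontier (rectU c v1 v2 η)) ≤
      ENNReal.ofReal (16 * (Real.log (1/2) - Real.log (2 * η))) := by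
  have hab : 2 * η < 1/2 := by linarith
  set L := Real.log (1/2) - Real.log (2 * η) with hLdef
  have hL : 0 < L := by
    rw [hLdef, sub_pos]; exact Real.log_lt_log (by positivity) hab
  set E : ℝ → ℝ := fun u => Real.exp (Real.log (2 * η) + u * L) with hE
  have hElog : ∀ u, Real.log (E u) = Real.log (2 * η) + u * L := fun u => Real.log_exp _
  have hE0 : E 0 = 2 * η := by simp [hE, Real.exp_log (by positivity : 0 < 2 * η)]
  have hE1 : E 1 = 1/2 := by
    simp only [hE, hLdef]
    rw [one_mul, add_sub_cancel, Real.exp_log (by norm_num)]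
  have hEm : ∀ u, 0 ≤ u → u ≤ 1 → 2 * η ≤ E u ∧ E u ≤ 1/2 := by
    intro u h0 h1
    constructor
    · rw [← hE0]; apply Real.exp_le_exp.2; nlinarith
    · rw [← hE1]; apply Real.exp_le_exp.2; nlinarith
  have hEs : ∀ x, 2 * η ≤ x → x ≤ 1/2 → ∃ u, 0 ≤ u ∧ u ≤ 1 ∧ E u = x := by
    intro x h0 h1
    have hx : 0 < x := by linarith
    have l0 := Real.log_le_log (by positivity) h0
    have l1 := Real.log_le_log hx h1
    refine ⟨(Real.log x - Real.log (2 * η)) / L, div_nonneg (by linarith) hL.le,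
      by rw [div_le_one hL]; linarith, ?_⟩
    simp only [hE]
    rw [div_mul_cancel₀ _ hL.ne', add_sub_cancel, Real.exp_log hx]
  have hUe : rectU c v1 v2 η = PPh c v1 v2 hd '' (Ioo (2 * η) (1/2) ×ˢ Ioo (2 * η) (1/2)) := rfl
  have hcl : closure (rectU c v1 v2 η) =
      PPh c v1 v2 hd '' (Icc (2 * η) (1/2) ×ˢ Icc (2 * η) (1/2)) := by
    rw [hUe, ← Homeomorph.image_closure, closure_prod_eq, closure_Ioo hab.ne]
  have hfr : frontier (rectU c v1 v2 η) =
      PPh c v1 v2 hd '' (Icc (2 * η) (1/2) ×ˢ {2 * η, 1/2} ∪ {2 * η, 1/2} ×ˢ Icc (2 * η) (1/2)) := by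
    rw [hUe, ← Homeomorph.image_frontier, frontier_prod_eq, closure_Ioo hab.ne, frontier_Ioo hab]
  set cur : ℝ → Euc 2 := fun t => PP c v1 v2 (E (lpx t)) (E (lpy t)) with hcur
  have him : cur '' Icc 0 1 = frontier (rectU c v1 v2 η) := by
    rw [hfr]
    ext p
    constructor
    · rintro ⟨t, ht, rfl⟩
      refine ⟨(E (lpx t), E (lpy t)), ?_, rfl⟩
      have hx := lpx_mem t
      have hy := lpy_mem t
      have hx' := hEm _ hx.1 hx.2
      have hy' := hEm _ hy.1 hy.2
      rcases lp_bd ht.1 ht.2 with h1 | h1 | h1 | h1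
      · right; exact ⟨Or.inl (by simp only [h1, hE0]), hy'⟩
      · right; exact ⟨Or.inr (by simp only [h1, hE1]; rfl), hy'⟩
      · left; exact ⟨hx', Or.inl (by simp only [h1, hE0])⟩
      · left; exact ⟨hx', Or.inr (by simp only [h1, hE1]; rfl)⟩
    · rintro ⟨⟨x, y⟩, hz, rfl⟩
      have : ∃ u w, 0 ≤ u ∧ u ≤ 1 ∧ 0 ≤ w ∧ w ≤ 1 ∧ (u = 0 ∨ u = 1 ∨ w = 0 ∨ w = 1) ∧
          E u = x ∧ E w = y := by
        rcases hz with ⟨h1, h2⟩ | ⟨h1, h2⟩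
        · obtain ⟨u, u0, u1, hu⟩ := hEs x h1.1 h1.2
          rcases h2 with h2 | h2
          · exact ⟨u, 0, u0, u1, le_rfl, zero_le_one, by simp, hu, by rw [hE0]; exact h2.symm⟩
          · exact ⟨u, 1, u0, u1, zero_le_one, le_rfl, by simp, hu, by rw [hE1]; exact h2.symm⟩
        · obtain ⟨u, u0, u1, hu⟩ := hEs y h2.1 h2.2
          rcases h1 with h1 | h1
          · exact ⟨0, u, le_rfl, zero_le_one, u0, u1, by simp, by rw [hE0]; exact h1.symm, hu⟩
          · exact ⟨1, u, zero_le_one, le_rfl, u0, u1, by simp, by rw [hE1]; exact h1.symm, hu⟩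
      obtain ⟨u, w, u0, u1, w0, w1, hb, rfl, rfl⟩ := this
      obtain ⟨t, ht, rfl, rfl⟩ := lp_surj u0 u1 w0 w1 hb
      exact ⟨t, ht, rfl⟩
  have hlip : ∀ s ∈ Icc (0:ℝ) 1, ∀ t ∈ Icc (0:ℝ) 1,
      hDist C (cur s) (cur t) ≤ (16 * L) * |s - t| := by
    intro s _ t _
    have hxs := hEm _ (lpx_mem s).1 (lpx_mem s).2
    have hys := hEm _ (lpy_mem s).1 (lpy_mem s).2
    have hxt := hEm _ (lpx_mem t).1 (lpx_mem t).2
    have hyt := hEm _ (lpy_mem t).1 (lpy_mem t).2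
    have m1 := b (E (lpx s)) (E (lpy s)) (by linarith) (by linarith) (by linarith) (by linarith)
    have m2 := b (E (lpx t)) (E (lpy s)) (by linarith) (by linarith) (by linarith) (by linarith)
    have m3 := b (E (lpx t)) (E (lpy t)) (by linarith) (by linarith) (by linarith) (by linarith)
    have tr := hDist_tri h m1 m2 m3
    have d1 := box_d3 h hη b (h1 := E (lpx s)) (h2 := E (lpx t)) (Y := E (lpy s)) hxs.1 hxt.1
      hxs.2 hxt.2 (by linarith) (by linarith)
    have d2 := box_d3 h hη b.swap (h1 := E (lpy s)) (h2 := E (lpy t)) (Y := E (lpx t)) hys.1 hyt.1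
      hys.2 hyt.2 (by linarith) (by linarith)
    rw [← PP_swap c v1 v2, ← PP_swap c v1 v2] at d2
    rw [hElog, hElog, add_sub_add_left_eq_sub, ← sub_mul, abs_mul, abs_of_pos hL] at d1 d2
    have := lpx_lip s t
    have := lpy_lip s t
    simp only [hcur]
    nlinarith
  have hH : hausD 1 (hDist C) (frontier (rectU c v1 v2 η)) ≤ ENNReal.ofReal (16 * L) := by
    rw [← him]
    exact hausD_lip (by positivity) hlip
  refine ⟨?_, ?_, ?_, ⟨cur, ?_, him, ?_, hH.trans_lt ENNReal.ofReal_lt_top⟩, hH⟩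
  · rw [hUe, Homeomorph.isOpen_image]
    exact isOpen_Ioo.prod isOpen_Ioo
  · exact Set.Nonempty.image _ ((nonempty_Ioo.2 hab).prod (nonempty_Ioo.2 hab))
  · rw [hcl]
    rintro _ ⟨⟨x, y⟩, ⟨hx, hy⟩, rfl⟩
    exact b x y (by linarith [hx.1]) (by linarith [hx.2]) (by linarith [hy.1]) (by linarith [hy.2])
  · apply Continuous.continuousOn
    simp only [hcur, hE, PP, lpx, lpy]
    fun_prop
  · simp only [hcur]
    have : lpx 0 = lpx 1 := by norm_num [lpx]
    have h2 : lpy 0 = lpy 1 := by norm_num [lpy]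
    rw [this, h2]
end

end

section
open MeasureTheory Set Filter
open scoped ENNReal NNReal

theorem hpow_disj {i j : ℕ} (hij : i ≠ j) :
    Disjoint (Ioo ((1/2:ℝ)^(i+1)) ((1/2)^i)) (Ioo ((1/2:ℝ)^(j+1)) ((1/2)^j)) := by
  rw [Set.disjoint_left]
  intro x h1 h2
  rcases lt_or_gt_of_ne hij with h | h
  · have : (1/2:ℝ)^j ≤ (1/2)^(i+1) := pow_le_pow_of_le_one (by norm_num) (by norm_num) h
    linarith [h1.1, h2.2]
  · have : (1/2:ℝ)^i ≤ (1/2)^(j+1) := pow_le_pow_of_le_one (by norm_num) (by norm_num) h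
    linarith [h1.2, h2.1]

section
variable {C : Set (Euc 2)} {c v1 v2 : Euc 2} {η : ℝ}

/-- dyadic cell -/
def cellU (c v1 v2 : Euc 2) (z : ℕ × ℕ) : Set (Euc 2) :=
  (fun w : ℝ × ℝ => PP c v1 v2 w.1 w.2) ''
    (Ioo ((1/2:ℝ)^(z.1+1)) ((1/2)^z.1) ×ˢ Ioo ((1/2:ℝ)^(z.2+1)) ((1/2)^z.2))

theorem SS_pos_vol (hd : det2 v1 v2 ≠ 0) (P : PosC C c v1 v2) {a b : ℝ} (ha : 0 < a) (hb : 0 < b)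
    {p : Euc 2} {x y : ℝ} (hp : p = PP c v1 v2 x y) (hx : x ≤ a) (hy : y ≤ b) :
    volume (SS C p) ≤ ENNReal.ofReal (4 * |det2 v1 v2| * (a * b)) := by
  have hs : SS C p ⊆ (fun z : ℝ × ℝ => (0 : Euc 2) + z.1 • v1 + z.2 • v2) ''
      (Icc (-a) a ×ˢ Icc (-b) b) := by
    intro u hu
    have hu1 := det2_decomp hd u
    set α := det2 u v2 / det2 v1 v2
    set β := det2 v1 u / det2 v1 v2
    have e1 : p + u = PP c v1 v2 (x + α) (y + β) := by
      rw [hp, hu1]; unfold PP; module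
    have e2 : p - u = PP c v1 v2 (x - α) (y - β) := by
      rw [hp, hu1]; unfold PP; module
    have h1 := hu.1
    have h2 := hu.2
    rw [e1] at h1
    rw [e2] at h2
    have k1 := P _ _ h1
    have k2 := P _ _ h2
    exact ⟨(α, β), ⟨⟨by linarith, by linarith⟩, ⟨by linarith, by linarith⟩⟩, by
      simp only [zero_add]; exact hu1.symm⟩
  refine (measure_mono hs).trans ?_
  rw [vol_par, Real.volume_Icc, Real.volume_Icc, ← ENNReal.ofReal_mul (by linarith),
    ← ENNReal.ofReal_mul (abs_nonneg _)]
  apply ENNReal.ofReal_le_ofReal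
  apply le_of_eq; ring

theorem cell_meas (h : HDom C) (hd : det2 v1 v2 ≠ 0) (P : PosC C c v1 v2) {z : ℕ × ℕ}
    (hC : cellU c v1 v2 z ⊆ C) : ENNReal.ofReal (omegaVol 2 / 64) ≤ hMeasure C (cellU c v1 v2 z) := by
  have hdp : 0 < |det2 v1 v2| := abs_pos.2 hd
  have hm : MeasurableSet (cellU c v1 v2 z) := by
    apply IsOpen.measurableSet
    exact (Homeomorph.isOpen_image (PPh c v1 v2 hd)).2 (isOpen_Ioo.prod isOpen_Ioo)
  have hv := vol_par c v1 v2 (Ioo ((1/2:ℝ)^(z.1+1)) ((1/2)^z.1)) (Ioo ((1/2:ℝ)^(z.2+1)) ((1/2)^z.2))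
  set a : ℝ := (1/2)^z.1 with ha
  set b : ℝ := (1/2)^z.2 with hb
  have ha0 : 0 < a := by positivity
  have hb0 : 0 < b := by positivity
  have := hM_ge hm hC (M := ENNReal.ofReal (omegaVol 2 / (4 * (4 * |det2 v1 v2| * (a * b))))) (by
    intro p hp
    obtain ⟨w, hw, rfl⟩ := id hp
    exact dens_ge h (hC hp) (by positivity) (SS_pos_vol hd P ha0 hb0 rfl hw.1.2.le hw.2.2.le))
  refine le_trans (le_of_eq ?_) this
  have hv' : volume (cellU c v1 v2 z) = _ := hv
  rw [hv', Real.volume_Ioo, Real.volume_Ioo, pow_succ, pow_succ, ← ha, ← hb,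
    ← ENNReal.ofReal_mul (by linarith),
    ← ENNReal.ofReal_mul (abs_nonneg _), ← ENNReal.ofReal_mul (by have := omega_pos; positivity)]
  congr 1
  field_simp
  ring

theorem rectU_meas (h : HDom C) (hd : det2 v1 v2 ≠ 0) (P : PosC C c v1 v2) (n : ℕ)
    (hC : rectU c v1 v2 ((1/2)^(n+2)) ⊆ C) :
    ENNReal.ofReal (n^2 * (omegaVol 2 / 64)) ≤ hMeasure C (rectU c v1 v2 ((1/2)^(n+2))) := by
  set S := Finset.Icc 1 n ×ˢ Finset.Icc 1 n with hS
  have hsub : ∀ z ∈ S, cellU c v1 v2 z ⊆ rectU c v1 v2 ((1/2)^(n+2)) := by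
    intro z hz
    rw [hS, Finset.mem_product, Finset.mem_Icc, Finset.mem_Icc] at hz
    apply image_mono
    have e : 2 * (1/2:ℝ)^(n+2) = (1/2)^(n+1) := by ring
    rw [e]
    have key : ∀ i : ℕ, 1 ≤ i ∧ i ≤ n →
        Ioo ((1/2:ℝ)^(i+1)) ((1/2)^i) ⊆ Ioo ((1/2:ℝ)^(n+1)) (1/2) := by
      intro i hi
      apply Ioo_subset_Ioo
      · exact pow_le_pow_of_le_one (by norm_num) (by norm_num) (by omega)
      · calc (1/2:ℝ)^i ≤ (1/2)^1 := pow_le_pow_of_le_one (by norm_num) (by norm_num) hi.1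
          _ = 1/2 := by norm_num
    exact prod_mono (key _ hz.1) (key _ hz.2)
  have hdis : (S : Set (ℕ × ℕ)).PairwiseDisjoint (cellU c v1 v2) := by
    intro z _ w _ hzw
    apply (disjoint_image_iff (PPh c v1 v2 hd).injective).2
    rw [Set.disjoint_prod]
    by_cases h1 : z.1 = w.1
    · right
      apply hpow_disj
      intro h2
      exact hzw (Prod.ext h1 h2)
    · left; exact hpow_disj h1
  have hmeas : ∀ z ∈ S, MeasurableSet (cellU c v1 v2 z) := by
    intro z _
    apply IsOpen.measurableSet
    exact (Homeomorph.isOpen_image (PPh c v1 v2 hd)).2 (isOpen_Ioo.prod isOpen_Ioo)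
  calc ENNReal.ofReal (n^2 * (omegaVol 2 / 64)) = ∑ z ∈ S, ENNReal.ofReal (omegaVol 2 / 64) := by
        rw [Finset.sum_const, hS, Finset.card_product, Nat.card_Icc, nsmul_eq_mul,
          ENNReal.ofReal_mul (by positivity)]
        simp [sq]
    _ ≤ ∑ z ∈ S, hMeasure C (cellU c v1 v2 z) :=
        Finset.sum_le_sum fun z hz => cell_meas h hd P ((hsub z hz).trans hC)
    _ = hMeasure C (⋃ z ∈ S, cellU c v1 v2 z) := (measure_biUnion_finset hdis hmeas).symm
    _ ≤ _ := measure_mono (iUnion₂_subset hsub)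

theorem cheeger_zero (h : HDom C) (H : ∀ η, 0 < η → Corner C η) : cheeger2 C = 0 := by
  have hnn : ∀ r ∈ {r : ℝ | ∃ U : Set (Euc 2), IsOpen U ∧ U.Nonempty ∧ closure U ⊆ C ∧
      RectCurveBoundary C U ∧
      r = (hausD 1 (hDist C) (frontier U)).toReal / (hMeasure C U).toReal}, 0 ≤ r := by
    rintro r ⟨U, _, _, _, _, rfl⟩
    positivity
  apply le_antisymm _ (Real.sInf_nonneg hnn)
  have hω := omega_pos
  have key : ∀ n : ℕ, 1 ≤ n → cheeger2 C ≤ (1024 * Real.log 2 / omegaVol 2) * (1 / n) := by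
    intro n hn
    have hη : (0:ℝ) < (1/2)^(n+2) := by positivity
    obtain ⟨c, v1, v2, hd, hB, hP⟩ := H _ hη
    have hlt : (1/2:ℝ)^(n+2) < 1/4 := by
      calc (1/2:ℝ)^(n+2) < (1/2)^2 := pow_lt_pow_right_of_lt_one₀ (by norm_num) (by norm_num) (by omega)
        _ = 1/4 := by norm_num
    obtain ⟨p1, p2, p3, p4, p5⟩ := rectU_props h hd hη hlt hB
    have hm := rectU_meas h hd hP n (subset_closure.trans p3)
    have hb : cheeger2 C ≤ _ := csInf_le ⟨0, hnn⟩ ⟨_, p1, p2, p3, p4, rfl⟩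
    refine hb.trans ?_
    have hn0 : (0:ℝ) < n := by exact_mod_cast hn
    have hlog : Real.log (1/2) - Real.log (2 * (1/2)^(n+2)) = n * Real.log 2 := by
      rw [show 2 * (1/2:ℝ)^(n+2) = (1/2)^(n+1) by ring, Real.log_pow, one_div, Real.log_inv]
      push_cast; ring
    rw [hlog] at p5
    have l2 : 0 < Real.log 2 := Real.log_pos (by norm_num)
    have p5' := ENNReal.toReal_mono ENNReal.ofReal_ne_top p5
    rw [ENNReal.toReal_ofReal (by positivity)] at p5'
    rcases eq_or_ne (hMeasure C (rectU c v1 v2 ((1/2)^(n+2)))) ⊤ with ht | ht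
    · rw [ht, ENNReal.toReal_top, div_zero]; positivity
    · have hm' := (ENNReal.ofReal_le_iff_le_toReal ht).1 hm
      calc _ ≤ (16 * (n * Real.log 2)) / (n^2 * (omegaVol 2 / 64)) := by gcongr
        _ = _ := by field_simp; norm_num
  have hlim : Tendsto (fun n : ℕ => (1024 * Real.log 2 / omegaVol 2) * (1 / (n:ℝ))) atTop (nhds 0) := by
    simpa using (tendsto_one_div_atTop_nhds_zero_nat (𝕜 := ℝ)).const_mul (1024 * Real.log 2 / omegaVol 2)
  refine ge_of_tendsto hlim ?_
  filter_upwards [eventually_ge_atTop 1] with n hn using key n hn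
end

end

section
open MeasureTheory Set Filter
open scoped ENNReal NNReal

section
variable {C : Set (Euc 2)} {o : Euc 2} {r0 R0 : ℝ}

theorem pigeon (c : Ctx C o r0 R0) (hD : ¬ ∃ ε, CondD C o ε) {η : ℝ} (h0 : 0 < η) (h1 : η < 1) :
    ∃ e s, BV C o e ∧ 0 < s ∧ s ≤ η ∧ WW C o e s ≤ (1 + η) * WW C o e (η * s) := by
  have hR := r0R0 c
  have hr := c.r0pos
  set c0 := r0 / (2 * R0) with hc0
  have hc0p : 0 < c0 := by positivity
  obtain ⟨n, hn⟩ := pow_unbounded_of_one_lt (2 / c0) (by linarith : 1 < 1 + η)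
  by_contra hcon
  push Not at hcon
  apply hD
  refine ⟨η * η^n, by positivity, ?_, ?_⟩
  · have : η^n ≤ 1 := pow_le_one₀ h0.le h1.le
    nlinarith
  intro e b σ hσ hσ1
  have hs : ∀ j : ℕ, 0 < η^j * (η * σ) ∧ η^j * (η * σ) ≤ η := by
    intro j
    have : η^j ≤ 1 := pow_le_one₀ h0.le h1.le
    refine ⟨by positivity, ?_⟩
    have : η * σ ≤ η := by nlinarith
    have : 0 < η * σ := by positivity
    nlinarith
  have hit : ∀ j : ℕ, (1 + η)^j * WW C o e (η^j * (η * σ)) ≤ WW C o e (η * σ) := by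
    intro j
    induction j with
    | zero => simp
    | succ k ih =>
      have := hcon e _ b (hs k).1 (hs k).2
      rw [← mul_assoc, ← pow_succ'] at this
      have hp : 0 < (1 + η)^k := by positivity
      rw [pow_succ]
      nlinarith
  have hm := WW_mono c b (s := η * σ) (s' := σ) (by positivity) (by nlinarith) hσ1
  rw [← hc0] at hm
  have hl := hit n
  have hW := WW_pos c b (hs n).1 ((hs n).2.trans h1.le)
  rw [show η * η^n * σ = η^n * (η * σ) by ring]
  rw [div_lt_iff₀ hc0p] at hn
  nlinarith

theorem conv3 (h : HDom C) {x y z : Euc 2} (hx : x ∈ C) (hy : y ∈ C) (hz : z ∈ C) {a b t : ℝ}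
    (ha : 0 < a) (hb : 0 < b) (ht : 0 ≤ t) (hs : a + b + t = 1) : a • x + b • y + t • z ∈ C := by
  have hab : 0 < a + b := by linarith
  have h1 : (a / (a + b)) • x + (b / (a + b)) • y ∈ C :=
    h.conv hx hy (by positivity) (by positivity) (by field_simp)
  have := h.conv h1 hz hab.le ht hs
  rw [smul_add, smul_smul, smul_smul, mul_div_cancel₀ _ hab.ne', mul_div_cancel₀ _ hab.ne'] at this
  exact this

set_option maxHeartbeats 1000000 in
theorem corner_of (c : Ctx C o r0 R0) {e : Euc 2} {s η : ℝ} (h0 : 0 < η)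
    (h1 : η ≤ 1/100) (hs : 0 < s) (hsη : s ≤ η) {f : Euc 2 →L[ℝ] ℝ} (hf : ∀ x ∈ C, f x < f (o + e))
    {u w : Euc 2} (hu : u ∈ SS C (qq o e (η * s))) (hw : w = u - (f u / f e) • e)
    (hdet : det2 e u ≠ 0) (hout : qq o e s + (1 + 4 * η) • w ∉ C) : Corner C (20 * η) := by
  have hfe : 0 < f e := by
    have := hf o c.ho
    rw [map_add] at this; linarith
  have hfw : f w = 0 := by
    rw [hw, map_sub, map_smul, smul_eq_mul, div_mul_cancel₀ _ hfe.ne', sub_self]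
  have hdw : det2 e w = det2 e u := by
    rw [hw]; unfold det2; simp; ring
  obtain ⟨r, hr⟩ := geometric_hahn_banach_open_point c.dom.conv c.dom.opn hout
  have hco : ∀ X Y : ℝ, o + e + X • w - (Y * s) • e ∈ C →
      0 < Y ∧ X * r w - Y * (s * r e) < (1 + 4 * η) * r w - s * r e := by
    intro X Y hm
    have k1 := hf _ hm
    have k2 := hr _ hm
    simp only [qq, map_add, map_sub, map_smul, smul_eq_mul, hfw] at k1 k2
    constructor
    · have : 0 < Y * (s * f e) := by linarith
      exact pos_of_mul_pos_left this (by positivity)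
    · linarith
  set θ := f u / f e / s with hθ
  have huw : u = w + (θ * s) • e := by
    rw [hw, hθ, div_mul_cancel₀ _ hs.ne']; module
  have m0 : o + e + (0:ℝ) • w - ((1/s) * s) • e ∈ C := by
    rw [one_div, inv_mul_cancel₀ hs.ne']
    have : o + e + (0:ℝ) • w - (1:ℝ) • e = o := by module
    rw [this]; exact c.ho
  have m1 : o + e + (1:ℝ) • w - ((η - θ) * s) • e ∈ C := by
    have := hu.1
    rw [huw, qq] at this
    convert this using 1; module
  have m2 : o + e + (-1:ℝ) • w - ((η + θ) * s) • e ∈ C := by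
    have := hu.2
    rw [huw, qq] at this
    convert this using 1; module
  obtain ⟨_, k0⟩ := hco _ _ m0
  obtain ⟨y1, k1⟩ := hco _ _ m1
  obtain ⟨y2, k2⟩ := hco _ _ m2
  set A := r w
  set B := s * r e
  have hsi : 100 ≤ 1 / s := by rw [le_div_iff₀ hs]; linarith
  have hsi2 : 1 / η ≤ 1 / s := one_div_le_one_div_of_le hs hsη
  have hA : 0 < A := by
    by_contra hA
    push Not at hA
    rcases le_total 0 B with hB | hB
    · nlinarith
    · nlinarith
  obtain ⟨m, hm⟩ : ∃ m, B = m * A := ⟨B / A, by rw [div_mul_cancel₀ _ hA.ne']⟩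
  rw [hm] at k0 k1 k2 hco
  have k0' : -(1/s) * m < 1 + 4 * η - m := by nlinarith
  have k1' : 1 - (η - θ) * m < 1 + 4 * η - m := by nlinarith
  have hm1 : m ≤ 8 * η := by
    by_contra hh
    push Not at hh
    nlinarith
  have hm2 : -(2 * η) ≤ m := by
    by_contra hh
    push Not at hh
    have e1 : 1 / η * η = 1 := by field_simp
    have : (1 / s - 1) * (2 * η) ≤ (1 / s - 1) * (-m) := by
      apply mul_le_mul_of_nonneg_left (by linarith) (by linarith)
    have : (1 / η - 1) * (2 * η) ≤ (1 / s - 1) * (2 * η) := by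
      apply mul_le_mul_of_nonneg_right (by linarith) (by linarith)
    nlinarith
  have hPP : ∀ h Y : ℝ, PP (o + e + (1 + 4 * η - m) • w) (-w) (m • w - s • e) h Y =
      o + e + (1 + 4 * η - m - h + m * Y) • w - (Y * s) • e := by
    intro h Y; unfold PP; module
  refine ⟨o + e + (1 + 4 * η - m) • w, -w, m • w - s • e, ?_, ?_, ?_⟩
  · have : det2 (-w) (m • w - s • e) = -(s * det2 e w) := by unfold det2; simp; ring
    rw [this, hdw]
    exact neg_ne_zero.2 (mul_ne_zero hs.ne' hdet)
  · intro h Y q1 q2 q3 q4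
    rw [hPP]
    have hX1 : 1 + 4 * η - m - h + m * Y ≤ 1 - 14 * η := by nlinarith
    have hX2 : -(4 * η) ≤ 1 + 4 * η - m - h + m * Y := by nlinarith
    set X := 1 + 4 * η - m - h + m * Y
    have hden : 1 / (2 * η) ≤ 1 / s - η := by
      have : 1 / η = 2 * (1 / (2 * η)) := by field_simp
      have : 50 ≤ 1 / (2 * η) := by rw [le_div_iff₀ (by positivity)]; linarith
      linarith
    have hden0 : 0 < 1 / s - η := lt_of_lt_of_le (by positivity) hden
    have hθX : |θ * X| ≤ η := by
      rw [abs_mul]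
      have a1 : |θ| ≤ η := abs_le.2 ⟨by linarith, by linarith⟩
      have a2 : |X| ≤ 1 := abs_le.2 ⟨by linarith, by linarith⟩
      nlinarith [abs_nonneg θ, abs_nonneg X]
    obtain ⟨hθ1, hθ2⟩ := abs_le.1 hθX
    set t := (Y - η + θ * X) / (1 / s - η) with ht
    have ht0 : 0 ≤ t := div_nonneg (by linarith) hden0.le
    have ht1 : t ≤ 2 * η := by
      rw [ht, div_le_iff₀ hden0]
      have : 2 * η * (1 / (2 * η)) = 1 := by field_simp
      nlinarith
    have hte : t * (1 / s - η) = Y - η + θ * X := by rw [ht, div_mul_cancel₀ _ hden0.ne']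
    have := conv3 c.dom m1 m2 m0 (a := (1 - t + X) / 2) (b := (1 - t - X) / 2) (t := t)
      (by linarith) (by linarith) ht0 (by ring)
    convert this using 1
    have hY : Y = (1 - t + X) / 2 * (η - θ) + (1 - t - X) / 2 * (η + θ) + t * (1 / s) := by
      linarith
    rw [hY]
    module
  · intro h Y hh
    rw [hPP] at hh
    obtain ⟨z1, z2⟩ := hco _ _ hh
    refine ⟨?_, z1⟩
    have : 0 < h * A := by linarith
    exact pos_of_mul_pos_left this hA.le

theorem corners (c : Ctx C o r0 R0) (hD : ¬ ∃ ε, CondD C o ε) : ∀ η, 0 < η → Corner C η := by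
  intro η' hη'
  obtain ⟨η, h0, h1, h2⟩ : ∃ η : ℝ, 0 < η ∧ η ≤ 1/100 ∧ 20 * η ≤ η' :=
    ⟨min (1/100) (η'/20), by positivity, min_le_left _ _, by linarith [min_le_right (1/100) (η'/20)]⟩
  suffices h : Corner C (20 * η) by
    obtain ⟨a, v1, v2, hd, hB, hP⟩ := h
    exact ⟨a, v1, v2, hd, fun h Y q1 q2 q3 q4 => hB h Y (by linarith) q2 (by linarith) q4, hP⟩
  obtain ⟨e, s, b, hs, hsη, hW⟩ := pigeon c hD h0 (by linarith)
  have hWp := WW_pos c b (s := η * s) (by positivity) (by nlinarith)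
  obtain ⟨u, hu, hud⟩ := WW_ex c b (s := η * s) (by positivity) (by nlinarith)
    (a := WW C o e s / (1 + 4 * η)) (by rw [div_lt_iff₀ (by positivity)]; nlinarith)
  rw [div_lt_iff₀ (by positivity)] at hud
  have hWs := WW_pos c b hs (by linarith)
  have hdp : 0 < det2 e u := by
    by_contra hh
    push Not at hh
    nlinarith
  obtain ⟨f, hf⟩ := geometric_hahn_banach_open_point c.dom.conv c.dom.opn b.out
  by_cases k1 : qq o e s + (1 + 4 * η) • (u - (f u / f e) • e) ∈ C
  · by_cases k2 : qq o e s + (1 + 4 * η) • (-u - (f (-u) / f e) • e) ∈ C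
    · exfalso
      have hmem : (1 + 4 * η) • (u - (f u / f e) • e) ∈ SS C (qq o e s) := by
        refine ⟨k1, ?_⟩
        convert k2 using 1
        rw [map_neg, neg_div]; module
      have := (le_abs_self _).trans (WW_ge c hmem)
      have e1 : det2 e ((1 + 4 * η) • (u - (f u / f e) • e)) = det2 e u * (1 + 4 * η) := by
        unfold det2; simp; ring
      linarith
    · refine corner_of c h0 h1 hs hsη hf (SS.neg hu) rfl ?_ k2
      rw [det2_neg]
      exact neg_ne_zero.2 hdp.ne'
  · exact corner_of c h0 h1 hs hsη hf hu rfl hdp.ne' k1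
end

end

section
open MeasureTheory Set Filter
open scoped ENNReal NNReal

section
variable {C : Set (Euc 2)} {o : Euc 2} {r0 R0 : ℝ}

theorem c0_bd (c : Ctx C o r0 R0) : 0 < r0 / (2 * R0) ∧ r0 / (2 * R0) ≤ 1/2 := by
  have hr := c.r0pos
  have hR := r0R0 c
  have hrR := r0leR0 c
  refine ⟨by positivity, ?_⟩
  rw [div_le_iff₀ (by positivity)]; linarith

theorem SS_up (c : Ctx C o r0 R0) {e : Euc 2} (b : BV C o e) {s s' : ℝ} (h0 : 0 < s)
    (hs : s ≤ s') (h1 : s' ≤ 1) {u : Euc 2} (hu : u ∈ SS C (qq o e s)) :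
    (r0 / (2 * R0)) • u ∈ SS C (qq o e s') := by
  have hr := c.r0pos
  have hR := r0R0 c
  obtain ⟨hc0, hc⟩ := c0_bd c
  have hq := b.mem c h0 (hs.trans h1)
  have hcu : (r0 / (2 * R0)) • u ∈ SS C (qq o e s) :=
    SS_smul c.dom hq hu (by rw [abs_of_pos hc0]; linarith)
  rcases eq_or_lt_of_le hs with rfl | hlt
  · exact hcu
  have hw : ‖(r0 / (2 * R0)) • u‖ < r0 := by
    rw [norm_smul, Real.norm_eq_abs, abs_of_pos hc0]
    calc r0 / (2 * R0) * ‖u‖ ≤ r0 / (2 * R0) * R0 := by gcongr; exact SS_norm c hu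
      _ = r0 / 2 := by field_simp
      _ < r0 := by linarith
  have hs1 : 0 < 1 - s := by linarith
  set l := (1 - s') / (1 - s) with hl
  have hl0 : 0 ≤ l := div_nonneg (by linarith) hs1.le
  have hl1 : l ≤ 1 := by rw [hl, div_le_one hs1]; linarith
  have hls : 1 - s' = l * (1 - s) := by rw [hl]; field_simp
  set w := (r0 / (2 * R0)) • u
  constructor
  · have := c.dom.conv hcu.1 (c.hin w hw) hl0 (by linarith : 0 ≤ 1 - l) (by ring)
    convert this using 1
    unfold qq; rw [hls]; module
  · have := c.dom.conv hcu.2 (c.hin (-w) (by rwa [norm_neg])) hl0 (by linarith : 0 ≤ 1 - l) (by ring)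
    convert this using 1
    unfold qq; rw [hls]; module

theorem dist_small (h : HDom C) {y y' : Euc 2} (hy : y ∈ C) (hy' : y' ∈ C) {d τ : ℝ}
    (hd : hDist C y y' ≤ d) (hd1 : d ≤ 1/4) (hτ : 4 * d < τ) (hτ0 : 0 < τ) :
    τ⁻¹ • (y' - y) ∈ SS C y := by
  obtain ⟨a, b, ⟨ha0, ha1, z, hz, hza⟩, ⟨hb0, hb1, z', hz', hzb⟩, he⟩ := hDist_ex h hy hy'
  have la := Real.log_nonpos ha0.le ha1
  have lb := Real.log_nonpos hb0.le hb1
  have hd0 : 0 ≤ d := (hDist_nonneg h hy hy').trans hd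
  have ka : 1 - 2 * d ≤ a := by
    rw [← Real.exp_log ha0]
    linarith [Real.add_one_le_exp (Real.log a)]
  have kb : 1 - 2 * d ≤ b := by
    rw [← Real.exp_log hb0]
    linarith [Real.add_one_le_exp (Real.log b)]
  constructor
  · set ρ := τ⁻¹ * (1 - a) with hρ
    have hρ0 : 0 ≤ ρ := mul_nonneg (by positivity) (by linarith)
    have hρ1 : ρ < 1 := by
      rw [hρ, inv_mul_lt_iff₀ hτ0]; linarith
    have := h.mix hy hz (by linarith : 0 < 1 - ρ) hρ0 (by ring)
    convert this using 1
    rw [hza, hρ]; module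
  · set ρ := τ⁻¹ * ((1 - b) / b) with hρ
    have hρ0 : 0 ≤ ρ := mul_nonneg (by positivity) (div_nonneg (by linarith) hb0.le)
    have hρ1 : ρ < 1 := by
      rw [hρ, inv_mul_lt_iff₀ hτ0, div_lt_iff₀ hb0]; nlinarith
    have := h.mix hy hz' (by linarith : 0 < 1 - ρ) hρ0 (by ring)
    convert this using 1
    have e1 : y' - y = ((1 - b) / b) • (y - z') := by
      have : b • (y' - y) = (1 - b) • (y - z') := by
        have : b • y' = y - (1 - b) • z' := eq_sub_of_add_eq hzb.symm
        rw [smul_sub, this]; module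
      rw [div_eq_inv_mul, mul_smul, ← this, smul_smul, inv_mul_cancel₀ hb0.ne', one_smul]
    rw [e1, smul_smul, ← hρ]; module

theorem SS_coord (c : Ctx C o r0 R0) {e : Euc 2} (b : BV C o e) {s : ℝ} (h0 : 0 < s)
    (h1 : s ≤ 1) {w u : Euc 2} (hw : w ∈ SS C (qq o e s)) (hW : WW C o e s < 2 * det2 e w)
    (hu : u ∈ SS C (qq o e s)) : |det2 u w / det2 e w| ≤ 3 * s ∧ |det2 e u / det2 e w| ≤ 2 := by
  have hWp := WW_pos c b h0 h1
  have hdw : 0 < det2 e w := by linarith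
  have hdec := det2_decomp hdw.ne' u
  have k2 : |det2 e u / det2 e w| ≤ 2 := by
    rw [abs_div, abs_of_pos hdw, div_le_iff₀ hdw]
    linarith [WW_ge c hu]
  refine ⟨?_, k2⟩
  set α := det2 u w / det2 e w
  set β := det2 e u / det2 e w
  have h1 := hu.1
  have h2 := hu.2
  rw [hdec, qq] at h1 h2
  have e1 := ue_lt c b (t := s - α) (β := β) hw (by convert h1 using 1; module)
  have e2 := ue_lt c b (t := s + α) (β := -β) hw (by convert h2 using 1; module)
  rw [abs_neg] at e2
  rw [abs_le]
  constructor <;> nlinarith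

theorem near_coord (c : Ctx C o r0 R0) {e : Euc 2} (b : BV C o e) {s : ℝ} (h0 : 0 < s)
    (h1 : s ≤ 1) {w y' : Euc 2} (hw : w ∈ SS C (qq o e s)) (hW : WW C o e s < 2 * det2 e w)
    (hy' : y' ∈ C) {d : ℝ} (hd : hDist C (qq o e s) y' ≤ d) (hd1 : d ≤ 1/4) :
    ∃ α β : ℝ, y' = o + (1 - s + α) • e + β • w ∧ |α| ≤ 12 * d * s ∧ |β| ≤ 8 * d := by
  have hWp := WW_pos c b h0 h1
  have hdw : 0 < det2 e w := by linarith
  have hy := b.mem c h0 h1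
  have hd0 : 0 ≤ d := (hDist_nonneg c.dom hy hy').trans hd
  have hdec := det2_decomp hdw.ne' (y' - qq o e s)
  have key : ∀ τ, 4 * d < τ → |det2 (y' - qq o e s) w / det2 e w| ≤ τ * (3 * s) ∧
      |det2 e (y' - qq o e s) / det2 e w| ≤ τ * 2 := by
    intro τ hτ
    have hτ0 : 0 < τ := by linarith
    obtain ⟨k1, k2⟩ := SS_coord c b h0 h1 hw hW (dist_small c.dom hy hy' hd hd1 hτ hτ0)
    have e1 : det2 (τ⁻¹ • (y' - qq o e s)) w / det2 e w =
        τ⁻¹ * (det2 (y' - qq o e s) w / det2 e w) := by unfold det2; simp; ring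
    have e2 : det2 e (τ⁻¹ • (y' - qq o e s)) / det2 e w =
        τ⁻¹ * (det2 e (y' - qq o e s) / det2 e w) := by unfold det2; simp; ring
    rw [e1, abs_mul, abs_of_pos (by positivity), inv_mul_le_iff₀ hτ0] at k1
    rw [e2, abs_mul, abs_of_pos (by positivity), inv_mul_le_iff₀ hτ0] at k2
    exact ⟨k1, k2⟩
  generalize det2 (y' - qq o e s) w / det2 e w = α at hdec key
  generalize det2 e (y' - qq o e s) / det2 e w = β at hdec key
  refine ⟨α, β, ?_, ?_, ?_⟩
  · rw [eq_add_of_sub_eq hdec, qq]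
    module
  · refine le_of_forall_pos_le_add fun x hx => ?_
    have := (key (4 * d + x / (3 * s)) (by linarith [div_pos hx (by positivity : 0 < 3 * s)])).1
    refine this.trans (le_of_eq ?_)
    field_simp; ring
  · refine le_of_forall_pos_le_add fun x hx => ?_
    have := (key (4 * d + x / 2) (by linarith)).2
    linarith

theorem SS_e (c : Ctx C o r0 R0) {e : Euc 2} (b : BV C o e) {σ : ℝ} (h0 : 0 < σ)
    (h1 : σ ≤ 1) : (r0 / (2 * R0) / 4 * σ) • e ∈ SS C (qq o e σ) := by
  obtain ⟨hc0, hc⟩ := c0_bd c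
  have hq := b.mem c h0 h1
  rcases le_total σ (1/2) with h | h
  · have := SS_smul c.dom hq (half_e c b h0 h) (a := r0 / (2 * R0) / 2)
      (by rw [abs_of_pos (by positivity)]; linarith)
    convert this using 1
    rw [smul_smul]; congr 1; ring
  · have := SS_up c b (s := 1/2) (by norm_num) h h1 (half_e c b (by norm_num) le_rfl)
    have := SS_smul c.dom hq this (a := σ) (by rw [abs_of_pos h0]; exact h1)
    convert this using 1
    rw [smul_smul, smul_smul]; congr 1; ring

theorem vol_near (c : Ctx C o r0 R0) {e : Euc 2} (b : BV C o e) {σ : ℝ} (h0 : 0 < σ)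
    (h1 : σ ≤ 1) {z : Euc 2} (hz : (2:ℝ) • z ∈ SS C (qq o e σ)) :
    ENNReal.ofReal (r0 / (2 * R0) / 32 * σ * WW C o e σ) ≤ volume (SS C (qq o e σ + z)) := by
  obtain ⟨hc0, hc⟩ := c0_bd c
  have hq := b.mem c h0 h1
  have hWp := WW_pos c b h0 h1
  obtain ⟨w, hw, hwd⟩ := WW_ex c b h0 h1 (a := WW C o e σ / 2) (by linarith)
  set k := r0 / (2 * R0) / 4 * σ with hk
  have hk0 : 0 < k := by positivity
  have hsub : (fun x : ℝ × ℝ => (0 : Euc 2) + x.1 • (k • e) + x.2 • w) ''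
      (Icc (-(1/4)) (1/4) ×ˢ Icc (-(1/4)) (1/4)) ⊆ SS C (qq o e σ + z) := by
    rintro _ ⟨⟨x, y⟩, ⟨⟨hx1, hx2⟩, ⟨hy1, hy2⟩⟩, rfl⟩
    simp only at hx1 hx2 hy1 hy2
    have hm := SS_comb c.dom hq (SS_e c b h0 h1) hw (a := 2 * x) (b := 2 * y) (by
      rw [abs_mul, abs_mul]
      have : |x| ≤ 1/4 := abs_le.2 ⟨by linarith, hx2⟩
      have : |y| ≤ 1/4 := abs_le.2 ⟨by linarith, hy2⟩
      norm_num; linarith)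
    rw [← hk] at hm
    constructor
    · have := c.dom.conv hz.1 hm.1 (a := 1/2) (b := 1/2) (by norm_num) (by norm_num) (by norm_num)
      convert this using 1
      simp only; module
    · have := c.dom.conv hz.1 hm.2 (a := 1/2) (b := 1/2) (by norm_num) (by norm_num) (by norm_num)
      convert this using 1
      simp only; module
  refine le_trans ?_ (measure_mono hsub)
  have e1 : det2 (k • e) w = k * det2 e w := by unfold det2; simp; ring
  have hdw : 0 < det2 e w := by linarith
  rw [vol_par, Real.volume_Icc, ← ENNReal.ofReal_mul (by norm_num),
    ← ENNReal.ofReal_mul (abs_nonneg _), e1, abs_of_pos (by positivity)]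
  apply ENNReal.ofReal_le_ofReal
  have : k * (WW C o e σ / 2) ≤ k * det2 e w := by gcongr
  rw [hk] at this ⊢
  nlinarith
end

end

section
open MeasureTheory Set Filter
open scoped ENNReal NNReal

section
variable {C : Set (Euc 2)} {o : Euc 2} {r0 R0 : ℝ}

theorem near_pt (c : Ctx C o r0 R0) {e : Euc 2} (b : BV C o e) {s : ℝ} (h0 : 0 < s)
    (h1 : s ≤ 1) {w : Euc 2} (hw : w ∈ SS C (qq o e s)) {σ β d : ℝ} (hσ : s / 2 ≤ σ)
    (hσ1 : σ ≤ 1 + 12 * d) (hβ : |β| ≤ 8 * d) (hd0 : 0 ≤ d) (hd : d ≤ r0 / (2 * R0) / 100) :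
    ∃ z, o + (1 - σ) • e + β • w = qq o e (min σ 1) + z ∧ (2:ℝ) • z ∈ SS C (qq o e (min σ 1)) := by
  obtain ⟨hc0, hc⟩ := c0_bd c
  have hr := c.r0pos
  have hR := r0R0 c
  rcases le_total σ 1 with hσ' | hσ'
  · rw [min_eq_left hσ']
    refine ⟨β • w, rfl, ?_⟩
    have hhalf : (1/2:ℝ) • w ∈ SS C (qq o e (s / 2)) := by
      constructor
      · have := c.dom.mix hw.1 b.cl (a := 1/2) (b := 1/2) (by norm_num) (by norm_num) (by norm_num)
        convert this using 1
        unfold qq; module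
      · have := c.dom.mix hw.2 b.cl (a := 1/2) (b := 1/2) (by norm_num) (by norm_num) (by norm_num)
        convert this using 1
        unfold qq; module
    have h2 := SS_up c b (by linarith) hσ hσ' hhalf
    have h3 := SS_smul c.dom (b.mem c (by linarith) hσ') h2 (a := 4 * β / (r0 / (2 * R0))) (by
      rw [abs_div, abs_of_pos hc0, div_le_one hc0, abs_mul]
      norm_num; linarith)
    convert h3 using 1
    rw [smul_smul, smul_smul, smul_smul]; congr 1; field_simp; ring
  · rw [min_eq_right hσ']
    refine ⟨(1 - σ) • e + β • w, by unfold qq; module, ?_⟩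
    have hn : ‖(2:ℝ) • ((1 - σ) • e + β • w)‖ < r0 := by
      have n1 : ‖(1 - σ) • e‖ ≤ 12 * d * R0 := by
        rw [norm_smul, Real.norm_eq_abs, abs_of_nonpos (by linarith)]
        have := b.norm_le c
        gcongr
        linarith
      have n2 : ‖β • w‖ ≤ 8 * d * R0 := by
        rw [norm_smul, Real.norm_eq_abs]
        have := SS_norm c hw
        gcongr
      have n3 := norm_add_le ((1 - σ) • e) (β • w)
      have n4 : d * R0 ≤ r0 / 200 := by
        calc d * R0 ≤ r0 / (2 * R0) / 100 * R0 := by gcongr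
          _ = r0 / 200 := by field_simp; norm_num
      rw [norm_smul]; norm_num
      linarith
    have hq : qq o e 1 = o := by unfold qq; module
    rw [hq]
    refine ⟨c.hin _ hn, ?_⟩
    rw [sub_eq_add_neg]
    exact c.hin _ (by rwa [norm_neg])

theorem dens_pt (c : Ctx C o r0 R0) {e : Euc 2} (b : BV C o e) {s : ℝ} (h0 : 0 < s)
    (h1 : s ≤ 1) {w : Euc 2} (hw : w ∈ SS C (qq o e s)) {σ β d a : ℝ} (hσ : s / 2 ≤ σ)
    (hσ1 : σ ≤ 1 + 12 * d) (hβ : |β| ≤ 8 * d) (hd0 : 0 ≤ d) (hd : d ≤ r0 / (2 * R0) / 100)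
    (ha : 0 < a) (ha1 : a ≤ 1) (haσ : a ≤ σ) (hx : o + (1 - σ) • e + β • w ∈ C) :
    dens C (o + (1 - σ) • e + β • w) ≤
      ENNReal.ofReal (omegaVol 2 / ((r0 / (2 * R0))^2 / 32 * a * WW C o e a)) := by
  obtain ⟨hc0, hc⟩ := c0_bd c
  obtain ⟨z, hz, hz2⟩ := near_pt c b h0 h1 hw hσ hσ1 hβ hd0 hd
  have hWa := WW_pos c b ha ha1
  have hmin : a ≤ min σ 1 := le_min haσ ha1
  have hm0 : 0 < min σ 1 := by linarith
  have hWm := WW_mono c b ha hmin (min_le_right _ _)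
  have hWp := WW_pos c b hm0 (min_le_right _ _)
  apply dens_le c.dom hx (by positivity)
  rw [hz]
  refine le_trans (ENNReal.ofReal_le_ofReal ?_) (vol_near c b hm0 (min_le_right _ _) hz2)
  calc (r0 / (2 * R0))^2 / 32 * a * WW C o e a
      = r0 / (2 * R0) / 32 * a * (r0 / (2 * R0) * WW C o e a) := by ring
    _ ≤ r0 / (2 * R0) / 32 * min σ 1 * WW C o e (min σ 1) := by gcongr

/-- the cone over a set -/
def coneS (o : Euc 2) (V : Set (Euc 2)) : Set (Euc 2) :=
  {x | ∃ y ∈ V, ∃ t : ℝ, 0 ≤ t ∧ t ≤ 1 ∧ x = o + t • (y - o)}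

theorem cone_meas (c : Ctx C o r0 R0) {ε : ℝ} (D : CondD C o ε) :
    ∃ K d0 : ℝ, 0 < K ∧ 0 < d0 ∧ ∀ V ⊆ C, ∀ d, 0 ≤ d → d ≤ d0 →
      (∀ y ∈ V, ∀ y' ∈ V, hDist C y y' ≤ d) → hMeasure C (coneS o V) ≤ ENNReal.ofReal (K * d) := by
  obtain ⟨hc0, hc⟩ := c0_bd c
  have hω := omega_pos
  obtain ⟨hε, hε1, -⟩ := id D
  set c0 := r0 / (2 * R0) with hc0def
  set K' := 2048 * omegaVol 2 / (c0^3 * ε) with hK'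
  have hK'0 : 0 < K' := by positivity
  refine ⟨2 * K', c0 / 100, by positivity, by positivity, ?_⟩
  intro V hV d hd0 hd hdist
  rcases V.eq_empty_or_nonempty with rfl | ⟨y, hy⟩
  · have : coneS o ∅ = ∅ := by ext x; simp [coneS]
    rw [this]; simp
  obtain ⟨e, s, b, hs, hs1, rfl⟩ := param c (hV hy)
  have hWs := WW_pos c b hs hs1
  obtain ⟨w, hw, hwd⟩ := WW_ex c b hs hs1 (a := WW C o e s / 2) (by linarith)
  have hdw : 0 < det2 e w := by linarith
  let a : ℕ → ℝ := fun k => s / 2 * (ε⁻¹)^k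
  have ha : ∀ k, 0 < a k := fun k => by positivity
  have has : ∀ k, s / 2 ≤ a k := fun k =>
    le_mul_of_one_le_right (by positivity) (one_le_pow₀ (by rw [one_le_inv₀ hε]; exact hε1.le))
  let Q : ℕ → Set (Euc 2) := fun k => if a k ≤ 1 then
    (fun z : ℝ × ℝ => (o + e) + z.1 • (-e) + z.2 • w) ''
      (Icc (a k) (min (2 * a k / ε) (1 + 12 * d)) ×ˢ Icc (-(8 * d)) (8 * d)) else ∅
  have hcov : coneS o V ⊆ ⋃ k, Q k := by
    rintro x ⟨y', hy', t, ht0, ht1, rfl⟩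
    obtain ⟨α, β, he, hα, hβ⟩ := near_coord c b hs hs1 hw (by linarith) (hV hy')
      (hdist _ hy _ hy') (by linarith)
    obtain ⟨α1, α2⟩ := abs_le.1 hα
    have hds : 12 * d * s ≤ s / 2 := by nlinarith
    have hds2 : 12 * d * s ≤ 12 * d := by nlinarith
    set σ := 1 - t * (1 - s + α) with hσ
    have g1 : s / 2 ≤ σ := by
      rcases le_total 0 (1 - s + α) with h | h
      · nlinarith
      · nlinarith
    have g2 : σ ≤ 1 + 12 * d := by
      rcases le_total 0 (1 - s + α) with h | h
      · nlinarith
      · nlinarith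
    have g3 : |t * β| ≤ 8 * d := by
      rw [abs_mul, abs_of_nonneg ht0]; nlinarith [abs_nonneg β]
    have hm1 : s / 2 ≤ min σ 1 := le_min g1 (by linarith)
    obtain ⟨k, hk1, hk2⟩ := exists_nat_pow_near (x := min σ 1 / (s / 2)) (y := ε⁻¹)
      (by rw [le_div_iff₀ (by positivity)]; linarith) ((one_lt_inv₀ hε).2 hε1)
    rw [le_div_iff₀' (by positivity)] at hk1
    rw [div_lt_iff₀' (by positivity), pow_succ, ← mul_assoc] at hk2
    change a k ≤ _ at hk1
    change _ < a k * ε⁻¹ at hk2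
    rw [← div_eq_mul_inv] at hk2
    have hak1 : a k ≤ 1 := hk1.trans (min_le_right _ _)
    rw [mem_iUnion]
    refine ⟨k, ?_⟩
    simp only [Q, if_pos hak1]
    refine ⟨(σ, t * β), ⟨⟨hk1.trans (min_le_left _ _), le_min ?_ g2⟩, abs_le.1 g3⟩, ?_⟩
    · have : σ ≤ 2 * min σ 1 := by
        rcases le_total σ 1 with h | h
        · rw [min_eq_left h]; linarith
        · rw [min_eq_right h]; linarith
      rw [mul_div_assoc]
      linarith
    · simp only
      rw [he, hσ]; module
  have hQ : ∀ k, hMeasure C (Q k) ≤ ENNReal.ofReal (K' * d * (1/2)^k) := by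
    intro k
    by_cases hk : a k ≤ 1
    swap
    · simp only [Q, if_neg hk]; simp
    simp only [Q, if_pos hk]
    have hWa := WW_pos c b (ha k) hk
    have hmeas : MeasurableSet ((fun z : ℝ × ℝ => (o + e) + z.1 • (-e) + z.2 • w) ''
      (Icc (a k) (min (2 * a k / ε) (1 + 12 * d)) ×ˢ Icc (-(8 * d)) (8 * d))) := by
      apply IsClosed.measurableSet
      apply IsCompact.isClosed
      exact (isCompact_Icc.prod isCompact_Icc).image (by fun_prop)
    refine (hM_le c.dom hmeas (M := ENNReal.ofReal (omegaVol 2 / (c0^2 / 32 * a k * WW C o e (a k))))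
      ?_).trans ?_
    · rintro p ⟨⟨σ, β⟩, ⟨⟨q1, q2⟩, q3⟩, rfl⟩ hp
      simp only at q1 q2 q3 hp ⊢
      have e1 : o + e + σ • (-e) + β • w = o + (1 - σ) • e + β • w := by module
      rw [e1] at hp ⊢
      exact dens_pt c b hs hs1 hw ((has k).trans q1) (q2.trans (min_le_right _ _)) (abs_le.2 q3) hd0
        hd (ha k) hk q1 hp
    · have hit := D.iter c b k (s := s / 2) (s' := a k) (by positivity) (by
        simp only [a]; rw [inv_pow]; apply le_of_eq; field_simp) (ha k) hk
      have hsc := WW_scale c b hs hs1 (l := 1/2) (by norm_num) (by norm_num)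
      rw [show 1 / 2 * s = s / 2 by ring] at hsc
      rw [← hc0def] at hit
      have hdet : |det2 (-e) w| ≤ 2 / c0 * (1/2)^k * WW C o e (a k) := by
        have e1 : det2 (-e) w = -(det2 e w) := by unfold det2; simp; ring
        rw [e1, abs_neg]
        refine (WW_ge c hw).trans ?_
        rw [mul_assoc, div_mul_eq_mul_div, le_div_iff₀ hc0]
        nlinarith
      have hvI : volume (Icc (a k) (min (2 * a k / ε) (1 + 12 * d))) ≤ ENNReal.ofReal (2 * a k / ε) := by
        rw [Real.volume_Icc]
        apply ENNReal.ofReal_le_ofReal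
        have := min_le_left (2 * a k / ε) (1 + 12 * d)
        linarith [ha k]
      rw [vol_par]
      have hak := ha k
      calc _ ≤ ENNReal.ofReal (omegaVol 2 / (c0^2 / 32 * a k * WW C o e (a k))) *
            (ENNReal.ofReal (2 / c0 * (1/2)^k * WW C o e (a k)) *
              (ENNReal.ofReal (2 * a k / ε) * ENNReal.ofReal (16 * d))) := by
            gcongr
            rw [Real.volume_Icc]
            apply ENNReal.ofReal_le_ofReal; linarith
        _ = ENNReal.ofReal (K' * d * (1/2)^k) := by
            rw [← ENNReal.ofReal_mul (by positivity), ← ENNReal.ofReal_mul (by positivity),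
              ← ENNReal.ofReal_mul (by positivity)]
            congr 1
            rw [hK']
            field_simp
            ring
  calc hMeasure C (coneS o V) ≤ hMeasure C (⋃ k, Q k) := measure_mono hcov
    _ ≤ ∑' k, hMeasure C (Q k) := measure_iUnion_le _
    _ ≤ ∑' k, ENNReal.ofReal (K' * d * (1/2)^k) := ENNReal.tsum_le_tsum hQ
    _ = ENNReal.ofReal (∑' k : ℕ, K' * d * (1/2)^k) :=
        (ENNReal.ofReal_tsum_of_nonneg (fun k => by positivity)
          (summable_geometric_two.mul_left _)).symm
    _ = ENNReal.ofReal (2 * K' * d) := by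
        rw [tsum_mul_left, tsum_geometric_two]; congr 1; ring

theorem pre_frontier {T U : Set (Euc 2)} (hT : IsPreconnected T) (h1 : (T ∩ U).Nonempty)
    (h2 : (T ∩ Uᶜ).Nonempty) : (T ∩ frontier U).Nonempty := by
  by_contra hcon
  rw [not_nonempty_iff_eq_empty] at hcon
  have hno : ∀ x ∈ T, x ∉ frontier U := fun x hx hf => by
    have : x ∈ T ∩ frontier U := ⟨hx, hf⟩
    rw [hcon] at this; exact this
  obtain ⟨x, hx, hxU⟩ := h1
  obtain ⟨y, hy, hyU⟩ := h2
  have key : ∀ z ∈ T, z ∈ interior U ∨ z ∈ (closure U)ᶜ := by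
    intro z hz
    by_contra hh
    push Not at hh
    exact hno z hz ⟨not_not.1 hh.2, hh.1⟩
  obtain ⟨z, _, hz1, hz2⟩ := hT (interior U) (closure U)ᶜ isOpen_interior isClosed_closure.isOpen_compl
    key ⟨x, hx, (key x hx).resolve_right fun h => h (subset_closure hxU)⟩
    ⟨y, hy, (key y hy).resolve_left fun h => hyU (interior_subset h)⟩
  exact hz2 (subset_closure (interior_subset hz1))

theorem cone_cover {U : Set (Euc 2)} (hb : Bornology.IsBounded U) :
    U ⊆ coneS o (frontier U) := by
  have key : ∀ x ∈ U, ∀ v : Euc 2, v ≠ 0 → ∃ τ : ℝ, 0 ≤ τ ∧ x + τ • v ∈ frontier U := by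
    intro x hx v hv
    have hpre : IsPreconnected ((fun τ : ℝ => x + τ • v) '' Ici 0) :=
      isPreconnected_Ici.image _ (by fun_prop)
    obtain ⟨R, hR⟩ := hb.exists_norm_le
    have hvn : 0 < ‖v‖ := norm_pos_iff.2 hv
    have hout : ((fun τ : ℝ => x + τ • v) '' Ici 0 ∩ Uᶜ).Nonempty := by
      have hR0 : 0 ≤ R := (norm_nonneg _).trans (hR x hx)
      refine ⟨_, ⟨(2 * R + 1) / ‖v‖, mem_Ici.2 (by positivity), rfl⟩, ?_⟩
      intro hm
      have h1 := hR _ hm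
      have h2 := norm_sub_le (x + ((2 * R + 1) / ‖v‖) • v) x
      simp only [add_sub_cancel_left] at h2
      rw [norm_smul, Real.norm_eq_abs, abs_of_nonneg (by positivity), div_mul_cancel₀ _ hvn.ne'] at h2
      simp only at h1
      linarith [hR x hx]
    obtain ⟨_, ⟨τ, hτ, rfl⟩, hf⟩ := pre_frontier hpre
      ⟨x, ⟨0, by simp, by simp⟩, hx⟩ hout
    exact ⟨τ, hτ, hf⟩
  intro x hx
  by_cases hxo : x = o
  · obtain ⟨v, hv⟩ := exists_ne (0 : Euc 2)
    obtain ⟨τ, _, hf⟩ := key x hx v hv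
    exact ⟨_, hf, 0, le_rfl, zero_le_one, by rw [hxo]; module⟩
  · obtain ⟨τ, hτ, hf⟩ := key x hx (x - o) (sub_ne_zero.2 hxo)
    refine ⟨_, hf, 1 / (1 + τ), by positivity, by rw [div_le_one (by positivity)]; linarith, ?_⟩
    have : x + τ • (x - o) - o = (1 + τ) • (x - o) := by module
    rw [this, smul_smul, one_div, inv_mul_cancel₀ (by positivity)]
    module

theorem iso (c : Ctx C o r0 R0) {ε : ℝ} (D : CondD C o ε) :
    ∃ K : ℝ, 0 < K ∧ ∀ U, closure U ⊆ C →
      hMeasure C U ≤ ENNReal.ofReal K * hausD 1 (hDist C) (frontier U) := by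
  obtain ⟨K, d0, hK, hd0, H⟩ := cone_meas c D
  refine ⟨K, hK, ?_⟩
  intro U hU
  have hb : Bornology.IsBounded U := c.dom.bdd.subset (subset_closure.trans hU)
  rw [← ENNReal.div_le_iff' (by simpa using hK) (by simp)]
  unfold hausD
  refine le_trans ?_ (le_iSup₂ (ENNReal.ofReal d0) (by simpa using hd0))
  refine le_iInf fun V => le_iInf fun hVc => le_iInf fun hVd => ?_
  rw [ENNReal.div_le_iff' (by simpa using hK) (by simp), ← ENNReal.tsum_mul_left]
  have hsub : U ⊆ ⋃ i, coneS o (V i ∩ frontier U) := by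
    intro x hx
    obtain ⟨y, hy, t, h0, h1, he⟩ := cone_cover (o := o) hb hx
    obtain ⟨i, hi⟩ := mem_iUnion.1 (hVc hy)
    exact mem_iUnion.2 ⟨i, y, ⟨hi, hy⟩, t, h0, h1, he⟩
  refine (measure_mono hsub).trans ((measure_iUnion_le _).trans (ENNReal.tsum_le_tsum fun i => ?_))
  have hfin : ediamD (hDist C) (V i) ≠ ⊤ := ((hVd i).trans_lt ENNReal.ofReal_lt_top).ne
  have := H (V i ∩ frontier U) (inter_subset_right.trans (frontier_subset_closure.trans hU))
    (ediamD (hDist C) (V i)).toReal ENNReal.toReal_nonneg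
    ((ENNReal.toReal_le_of_le_ofReal hd0.le (hVd i))) (by
      intro y hy y' hy'
      apply (ENNReal.ofReal_le_iff_le_toReal hfin).1
      exact (le_iSup₂ (f := fun y' (_ : y' ∈ V i) => ENNReal.ofReal (hDist C y y')) y' hy'.1).trans
        (le_iSup₂ (f := fun y (_ : y ∈ V i) => ⨆ y' ∈ V i, ENNReal.ofReal (hDist C y y')) y hy.1))
  rw [ENNReal.ofReal_mul hK.le, ENNReal.ofReal_toReal hfin] at this
  rw [ENNReal.rpow_one]
  exact this

theorem meas_pos (c : Ctx C o r0 R0) {U : Set (Euc 2)} (hU : IsOpen U) (hne : U.Nonempty)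
    (hUC : U ⊆ C) : 0 < hMeasure C U := by
  have hR := r0R0 c
  have hω := omega_pos
  set v := (volume (Metric.closedBall (0 : Euc 2) R0)).toReal with hv
  have hfin : volume (Metric.closedBall (0 : Euc 2) R0) ≠ ⊤ := measure_closedBall_lt_top.ne
  have hv0 : 0 < v := ENNReal.toReal_pos (Metric.measure_closedBall_pos _ _ hR).ne' hfin
  refine lt_of_lt_of_le ?_ (hM_ge hU.measurableSet hUC
    (M := ENNReal.ofReal (omegaVol 2 / (4 * v))) ?_)
  · apply ENNReal.mul_pos
    · have : 0 < omegaVol 2 / (4 * v) := by positivity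
      simpa using this
    · exact (hU.measure_pos _ hne).ne'
  · intro p hp
    apply dens_ge c.dom (hUC hp) hv0
    rw [hv, ENNReal.ofReal_toReal hfin]
    apply measure_mono
    intro u hu
    simpa using SS_norm c hu

theorem cheeger_pos (c : Ctx C o r0 R0) {ε : ℝ} (D : CondD C o ε) : cheeger2 C ≠ 0 := by
  obtain ⟨K, hK, H⟩ := iso c D
  have hr := c.r0pos
  suffices h : 1 / K ≤ cheeger2 C by
    have : 0 < 1 / K := by positivity
    linarith
  apply le_csInf
  · let v1 : Euc 2 := EuclideanSpace.single 0 (r0 / 3)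
    let v2 : Euc 2 := EuclideanSpace.single 1 (r0 / 3)
    have hd : det2 v1 v2 ≠ 0 := by
      simp [det2, v1, v2, hr.ne']
    have hB : Box C (1/8) o v1 v2 := by
      intro h Y a1 a2 a3 a4
      unfold PP
      rw [add_assoc]
      apply c.hin
      refine (norm_add_le _ _).trans_lt ?_
      rw [norm_smul, norm_smul]
      simp only [v1, v2, EuclideanSpace.norm_single, Real.norm_eq_abs]
      rw [abs_of_pos (by linarith), abs_of_pos (by linarith), abs_of_pos (by positivity)]
      nlinarith
    obtain ⟨p1, p2, p3, p4, _⟩ := rectU_props c.dom hd (by norm_num) (by norm_num) hB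
    exact ⟨_, _, p1, p2, p3, p4, rfl⟩
  · rintro r ⟨U, hU, hne, hcl, hrc, rfl⟩
    obtain ⟨_, _, _, _, hfin⟩ := hrc
    have h1 := H U hcl
    have h2 := meas_pos c hU hne (subset_closure.trans hcl)
    have hft : ENNReal.ofReal K * hausD 1 (hDist C) (frontier U) ≠ ⊤ :=
      (ENNReal.mul_lt_top ENNReal.ofReal_lt_top hfin).ne
    have h3 := ENNReal.toReal_mono hft h1
    rw [ENNReal.toReal_mul, ENNReal.toReal_ofReal hK.le] at h3
    have h4 := ENNReal.toReal_pos h2.ne' (h1.trans_lt hft.lt_top).ne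
    rw [div_le_div_iff₀ hK h4]
    linarith

theorem stmt_main (h : HDom C) (hne : C.Nonempty) :
    cheeger2 C ≠ 0 ↔ ∃ δ : ℝ, 0 ≤ δ ∧ IsDeltaHyp C δ := by
  obtain ⟨o, r0, R0, c⟩ := ctx_exists h hne
  by_cases hD : ∃ ε, CondD C o ε
  · obtain ⟨ε, D⟩ := hD
    exact ⟨fun _ => hyp_of_D c D, fun _ => cheeger_pos c D⟩
  · have H := corners c hD
    exact ⟨fun h' => absurd (cheeger_zero h H) h', fun h' => absurd h' (not_hyp h H)⟩
end

end



/-- for a bounded open convex subset `C` of `ℝ²`, the Cheeger constant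
`I_∞(C)` is nonzero if and only if `(C, d_C)` is Gromov hyperbolic. -/
theorem stmt16 (C : Set (Euc 2)) (hconv : Convex ℝ C) (hopen : IsOpen C)
    (hbdd : Bornology.IsBounded C) (hne : C.Nonempty) :
    cheeger2 C ≠ 0 ↔ ∃ δ : ℝ, 0 ≤ δ ∧ IsDeltaHyp C δ := by
  exact stmt_main ⟨hconv, hopen, hbdd⟩ hne
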